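/- arXiv:1404.4445 — 2 statements merged into one kernel-verified Lean document; each statement's English description precedes it below -/
import Mathlib

section
/- (Korn's inequality, periodic case.) Let d ≥ 2 and q ∈ (1,∞). There exists a constant c_k > 0, depending only on d and q, such that for every smooth 2π-periodic vector field u : ℝ^d → ℝ^d with ∫_Ω u(x) dx = 0, one has c_k (∫_Ω |∇u(x)|^q dx)^{1/q} ≤ (∫_Ω |Du(x)|^q dx)^{1/q}. -/
open MeasureTheory Real

noncomputable section

/-- Partial derivative in direction `i` of a scalar function on `ℝ^d`. -/
def pd {d : ℕ} (f : (Fin d → ℝ) → ℝ) (i : Fin d) (x : Fin d → ℝ) : ℝ :=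
  fderiv ℝ f x (Pi.single i 1)

/-- The periodic box `Ω = (0, 2π)^d`. -/
def box (d : ℕ) : Set (Fin d → ℝ) := Set.univ.pi fun _ => Set.Ioo 0 (2 * π)

/-- `2π`-periodicity in every coordinate direction. -/
def IsPer {d : ℕ} {E : Type*} (g : (Fin d → ℝ) → E) : Prop :=
  ∀ (x : Fin d → ℝ) (i : Fin d), g (x + Pi.single i (2 * π)) = g x

/-- Frobenius norm of a `d × d` matrix. -/
def frob {d : ℕ} (M : Fin d → Fin d → ℝ) : ℝ := Real.sqrt (∑ i, ∑ j, M i j ^ 2)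

/-- Inner (double-dot) product of `d × d` matrices: `A : B = ∑ᵢⱼ Aᵢⱼ Bᵢⱼ`. -/
def minner {d : ℕ} (A B : Fin d → Fin d → ℝ) : ℝ := ∑ i, ∑ j, A i j * B i j

/-- Symmetry of a `d × d` matrix. -/
def Symm {d : ℕ} (A : Fin d → Fin d → ℝ) : Prop := ∀ i j, A i j = A j i

/-- The gradient matrix `(∇u)ᵢⱼ = ∂ⱼuᵢ` of a vector field. -/
def gradM {d : ℕ} (u : (Fin d → ℝ) → (Fin d → ℝ)) (x : Fin d → ℝ) : Fin d → Fin d → ℝ :=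
  fun i j => pd (fun y => u y i) j x

/-- The symmetric part `Du = ½(∇u + (∇u)ᵀ)` of the gradient. -/
def symG {d : ℕ} (u : (Fin d → ℝ) → (Fin d → ℝ)) (x : Fin d → ℝ) : Fin d → Fin d → ℝ :=
  fun i j => (gradM u x i j + gradM u x j i) / 2

/-- Componentwise Laplacian `Δuᵢ = ∑ₖ ∂ₖ∂ₖ uᵢ`. -/
def lap {d : ℕ} (u : (Fin d → ℝ) → (Fin d → ℝ)) (i : Fin d) (x : Fin d → ℝ) : ℝ :=
  ∑ k, pd (pd (fun y => u y i) k) k x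

/-- Divergence-free condition `div u = ∑ᵢ ∂ᵢuᵢ = 0` everywhere. -/
def DivFree {d : ℕ} (u : (Fin d → ℝ) → (Fin d → ℝ)) : Prop :=
  ∀ x, ∑ i, pd (fun y => u y i) i x = 0

/-! ## Part A: the box and periodic functions -/

/-- the character `e^{i k·x}` -/
def ee {d : ℕ} (k : Fin d → ℤ) (x : Fin d → ℝ) : ℂ :=
  Complex.exp (Complex.I * ((∑ i, (k i : ℝ) * x i : ℝ) : ℂ))

lemma box_ae_eq_Icc (d : ℕ) :
    (box d : Set (Fin d → ℝ)) =ᵐ[volume] Set.Icc (fun _ => (0 : ℝ)) (fun _ => 2 * π) :=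
  Measure.univ_pi_Ioo_ae_eq_Icc (f := fun _ : Fin d => (0 : ℝ)) (g := fun _ : Fin d => 2 * π)

lemma restrict_box (d : ℕ) :
    (volume : Measure (Fin d → ℝ)).restrict (box d)
      = volume.restrict (Set.Icc (fun _ => (0 : ℝ)) (fun _ => 2 * π)) :=
  Measure.restrict_congr_set (box_ae_eq_Icc d)

instance finite_box (d : ℕ) : IsFiniteMeasure ((volume : Measure (Fin d → ℝ)).restrict (box d)) := by
  rw [restrict_box]
  exact isFiniteMeasure_restrict.2 isCompact_Icc.measure_lt_top.ne

lemma Continuous.integrable_box {d : ℕ} {E : Type*} [NormedAddCommGroup E]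
    {f : (Fin d → ℝ) → E} (hf : Continuous f) :
    Integrable f (volume.restrict (box d)) := by
  rw [restrict_box]
  exact hf.continuousOn.integrableOn_compact isCompact_Icc

lemma continuous_box_param {d : ℕ} {X E : Type*} [TopologicalSpace X]
    [FirstCountableTopology X] [LocallyCompactSpace X]
    [NormedAddCommGroup E] [NormedSpace ℝ E]
    {f : X → (Fin d → ℝ) → E} (hf : Continuous f.uncurry) :
    Continuous fun t => ∫ x in box d, f t x := by
  simp_rw [restrict_box]
  exact continuous_parametric_integral_of_continuous hf isCompact_Icc

/-- differentiation under the integral -/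
lemma hasDerivAt_box {d : ℕ} {E : Type*} [NormedAddCommGroup E] [NormedSpace ℝ E]
    {f f' : ℝ → (Fin d → ℝ) → E} (hf : Continuous f.uncurry) (hf' : Continuous f'.uncurry)
    (h : ∀ t x, HasDerivAt (fun t => f t x) (f' t x) t) (t : ℝ) :
    HasDerivAt (fun t => ∫ x in box d, f t x) (∫ x in box d, f' t x) t := by
  rw [restrict_box]
  have hc : ∀ t, Continuous (f t) := fun t => hf.comp (by fun_prop : Continuous fun x => (t, x))
  have hc' : ∀ t, Continuous (f' t) := fun t => hf'.comp (by fun_prop : Continuous fun x => (t, x))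
  obtain ⟨M, hM⟩ := ((isCompact_Icc (a := t - 1) (b := t + 1)).prod
    (isCompact_Icc (a := fun _ : Fin d => (0 : ℝ)) (b := fun _ => 2 * π))).exists_bound_of_continuousOn
    hf'.continuousOn
  refine (hasDerivAt_integral_of_dominated_loc_of_deriv_le (s := Set.Icc (t - 1) (t + 1))
    (bound := fun _ => M) (Icc_mem_nhds (by linarith) (by linarith))
    (Filter.Eventually.of_forall fun s => (hc s).aestronglyMeasurable) ?_
    (hc' t).aestronglyMeasurable ?_ ?_ ?_).2
  · exact (hc t).continuousOn.integrableOn_compact isCompact_Icc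
  · filter_upwards [ae_restrict_mem measurableSet_Icc] with x hx s hs
    exact hM (s, x) ⟨hs, hx⟩
  · rw [← restrict_box]
    exact integrable_const _
  · exact Filter.Eventually.of_forall fun x s _ => h s x

instance fact_two_pi : Fact (0 < 2 * π) := ⟨by positivity⟩

lemma IsPer.add_int {d : ℕ} {E : Type*} {g : (Fin d → ℝ) → E} (hg : IsPer g)
    (n : Fin d → ℤ) (x : Fin d → ℝ) : g (x + fun i => n i • (2 * π)) = g x := by
  have h1 : ∀ s : Finset (Fin d), Function.Periodic g (∑ i ∈ s, n i • Pi.single i (2 * π)) := by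
    intro s
    induction s using Finset.induction_on with
    | empty => intro x; simp
    | insert a s ha ih =>
      rw [Finset.sum_insert ha]
      have : Function.Periodic g (Pi.single a (2 * π)) := fun x => hg x a
      exact (this.zsmul (n a)).add_period ih
  have h2 : (fun i => n i • (2 * π)) = ∑ i, n i • (Pi.single i (2 * π) : Fin d → ℝ) := by
    ext j
    simp [Finset.sum_apply, Pi.single_apply]
  rw [h2]
  exact h1 _ x

/-- transfer to torus -/
def toT {d : ℕ} (x : Fin d → ℝ) : Fin d → AddCircle (2 * π) := fun i => (x i : AddCircle (2 * π))

def liftT {d : ℕ} {E : Type*} (f : (Fin d → ℝ) → E) (y : Fin d → AddCircle (2 * π)) : E :=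
  f fun i => (AddCircle.measurableEquivIoc (2 * π) 0 (y i) : ℝ)

lemma liftT_toT {d : ℕ} {E : Type*} {f : (Fin d → ℝ) → E} (hf : IsPer f) (x : Fin d → ℝ) :
    liftT f (toT x) = f x := by
  have : ∀ i, ∃ n : ℤ, (AddCircle.measurableEquivIoc (2 * π) 0 (toT x i) : ℝ) = x i + n • (2 * π) := by
    intro i
    have h : ((AddCircle.equivIoc (2 * π) 0 (toT x i) : ℝ) : AddCircle (2 * π)) = (x i : ℝ) :=
      AddCircle.coe_equivIoc
    have h' : (((AddCircle.equivIoc (2 * π) 0 (toT x i) : ℝ) - x i : ℝ) : AddCircle (2 * π)) = 0 := by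
      rw [AddCircle.coe_sub, h, sub_self]
    obtain ⟨n, hn⟩ := (AddCircle.coe_eq_zero_iff _).1 h'
    refine ⟨n, ?_⟩
    rw [hn]
    change (AddCircle.equivIoc (2 * π) 0 (toT x i) : ℝ) = _
    ring
  choose n hn using this
  unfold liftT
  rw [← hf.add_int n x]
  congr 1
  ext i
  simp [hn]

lemma measurePreserving_toT (d : ℕ) :
    MeasurePreserving (toT (d := d)) (volume.restrict (box d)) volume := by
  have h := measurePreserving_pi (fun _ : Fin d => (volume : Measure ℝ).restrict (Set.Ioc 0 (0 + 2 * π)))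
    (fun _ => (volume : Measure (AddCircle (2 * π)))) (fun i => AddCircle.measurePreserving_mk (2 * π) 0)
  have h2 : (volume : Measure (Fin d → ℝ)).restrict (box d)
      = Measure.pi (fun _ : Fin d => (volume : Measure ℝ).restrict (Set.Ioc 0 (0 + 2 * π))) := by
    simp_rw [zero_add, ← Measure.restrict_congr_set (Ioo_ae_eq_Ioc (a := (0:ℝ)) (b := 2 * π) (μ := volume))]
    rw [box, volume_pi, Measure.restrict_pi_pi]
  rw [h2]
  exact h

lemma integral_toT {d : ℕ} {E : Type*} [NormedAddCommGroup E] [NormedSpace ℝ E]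
    {f : (Fin d → AddCircle (2 * π)) → E} (hf : StronglyMeasurable f) :
    ∫ x in box d, f (toT x) = ∫ y, f y := by
  rw [← (measurePreserving_toT d).map_eq, integral_map (measurePreserving_toT d).aemeasurable
    hf.aestronglyMeasurable]

lemma liftT_meas {d : ℕ} {E : Type*} [NormedAddCommGroup E]
    {f : (Fin d → ℝ) → E} (hf : Continuous f) : StronglyMeasurable (liftT f) := by
  refine hf.stronglyMeasurable.comp_measurable (measurable_pi_lambda _ fun i => ?_)
  exact measurable_subtype_coe.comp ((AddCircle.measurableEquivIoc (2 * π) 0).measurable.comp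
    (measurable_pi_apply i))

lemma integral_box_add {d : ℕ} {E : Type*} [NormedAddCommGroup E] [NormedSpace ℝ E]
    {f : (Fin d → ℝ) → E} (hf : Continuous f) (hp : IsPer f) (c : Fin d → ℝ) :
    ∫ x in box d, f (x + c) = ∫ x in box d, f x := by
  have h1 : ∀ x, f (x + c) = liftT f (toT x + toT c) := fun x => by
    rw [← liftT_toT hp]; congr 1
  simp_rw [h1]
  rw [integral_toT (f := fun y => liftT f (y + toT c))
    ((liftT_meas hf).comp_measurable (measurable_add_const _)),
    integral_add_right_eq_self, ← integral_toT (liftT_meas hf)]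
  simp_rw [liftT_toT hp]

instance negInv_circle : (volume : Measure (AddCircle (2 * π))).IsNegInvariant :=
  Measure.IsAddHaarMeasure.isNegInvariant_of_regular _

lemma integral_box_sub {d : ℕ} {E : Type*} [NormedAddCommGroup E] [NormedSpace ℝ E]
    {f : (Fin d → ℝ) → E} (hf : Continuous f) (hp : IsPer f) (c : Fin d → ℝ) :
    ∫ x in box d, f (c - x) = ∫ x in box d, f x := by
  have h1 : ∀ x, f (c - x) = liftT f (toT c - toT x) := fun x => by
    rw [← liftT_toT hp]; congr 1
  simp_rw [h1]
  rw [integral_toT (f := fun y => liftT f (toT c - y))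
    ((liftT_meas hf).comp_measurable (measurable_const_sub _)),
    integral_sub_left_eq_self (liftT f) volume, ← integral_toT (liftT_meas hf)]
  simp_rw [liftT_toT hp]

lemma integral_box_deriv {d : ℕ} {E : Type*} [NormedAddCommGroup E] [NormedSpace ℝ E]
    {f : (Fin d → ℝ) → E} {v : Fin d → ℝ} {f' : (Fin d → ℝ) → E} (hf : Continuous f) (hp : IsPer f)
    (hf' : Continuous f') (h : ∀ x, HasDerivAt (fun t : ℝ => f (x + t • v)) (f' x) 0) :
    ∫ x in box d, f' x = 0 := by
  have h1 := hasDerivAt_box (d := d) (f := fun t x => f (x + t • v)) (f' := fun t x => f' (x + t • v))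
    (by unfold Function.uncurry; fun_prop) (by unfold Function.uncurry; fun_prop) (fun t x => by
      have h2 := h (x + t • v)
      rw [← sub_self t] at h2
      refine (h2.comp_sub_const t t).congr_of_eventuallyEq (Filter.Eventually.of_forall fun s => ?_)
      simp only [sub_smul]
      congr 1
      abel) 0
  simp_rw [integral_box_add hf hp] at h1
  simpa using h1.unique (hasDerivAt_const _ _)

lemma ee_continuous {d : ℕ} (k : Fin d → ℤ) : Continuous (ee k) := by
  unfold ee; fun_prop

lemma ee_add {d : ℕ} (k : Fin d → ℤ) (x y : Fin d → ℝ) : ee k (x + y) = ee k x * ee k y := by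
  unfold ee
  rw [← Complex.exp_add, ← mul_add, ← Complex.ofReal_add, ← Finset.sum_add_distrib]
  simp [mul_add]

lemma ee_isPer {d : ℕ} (k : Fin d → ℤ) : IsPer (ee k) := by
  intro x i
  rw [ee_add]
  have : ee k (Pi.single i (2 * π)) = 1 := by
    unfold ee
    simp only [Pi.single_apply, mul_ite, mul_zero, Finset.sum_ite_eq', Finset.mem_univ, if_true]
    rw [Complex.exp_eq_one_iff]
    refine ⟨k i, ?_⟩
    push_cast; ring
  rw [this, mul_one]

lemma ee_norm {d : ℕ} (k : Fin d → ℤ) (x : Fin d → ℝ) : ‖ee k x‖ = 1 := by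
  unfold ee
  rw [mul_comm, Complex.norm_exp_ofReal_mul_I]

lemma ee_neg {d : ℕ} (k : Fin d → ℤ) (x : Fin d → ℝ) : ee k (-x) = ee (-k) x := by
  unfold ee; simp

lemma ee_add_left {d : ℕ} (k l : Fin d → ℤ) (x : Fin d → ℝ) : ee (k + l) x = ee k x * ee l x := by
  unfold ee
  rw [← Complex.exp_add, ← mul_add, ← Complex.ofReal_add, ← Finset.sum_add_distrib]
  simp [add_mul]

lemma ee_conj {d : ℕ} (k : Fin d → ℤ) (x : Fin d → ℝ) :
    (starRingEnd ℂ) (ee k x) = ee (-k) x := by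
  unfold ee
  rw [← Complex.exp_conj]
  simp



/-! ## Part B: subharmonic mean inequality -/

lemma convex_limit {φ ψ χ : ℝ → ℝ} {L : ℝ} (h1 : ∀ s, HasDerivAt φ (ψ s) s)
    (h2 : ∀ s, HasDerivAt ψ (χ s) s) (h3 : ∀ s, 0 ≤ χ s)
    (hL : Filter.Tendsto φ Filter.atTop (nhds L)) : L ≤ φ 0 := by
  have hmono : Monotone ψ := monotone_of_hasDerivAt_nonneg h2 h3
  have hneg : ∀ s, ψ s ≤ 0 := by
    intro s₀
    by_contra hc
    push Not at hc
    have hlow : ∀ s, s₀ ≤ s → φ s₀ + ψ s₀ * (s - s₀) ≤ φ s := by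
      intro s hs
      have hm : MonotoneOn (fun s => φ s - ψ s₀ * (s - s₀)) (Set.Ici s₀) := by
        have hd : ∀ s, HasDerivAt (fun s => φ s - ψ s₀ * (s - s₀)) (ψ s - ψ s₀) s := fun s => by
          simpa using (h1 s).fun_sub (((hasDerivAt_id s).sub_const s₀).const_mul (ψ s₀))
        refine monotoneOn_of_deriv_nonneg (convex_Ici _)
          (fun s _ => (hd s).continuousAt.continuousWithinAt)
          (fun s _ => (hd s).differentiableAt.differentiableWithinAt) (fun s hs => ?_)
        rw [(hd s).deriv]
        rw [interior_Ici] at hs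
        exact sub_nonneg.2 (hmono hs.le)
      have := hm (Set.self_mem_Ici) (Set.mem_Ici.2 hs) hs
      simp at this
      linarith
    have ht : Filter.Tendsto (fun s => φ s₀ + ψ s₀ * (s - s₀)) Filter.atTop Filter.atTop := by
      apply Filter.tendsto_atTop_add_const_left
      apply Filter.Tendsto.const_mul_atTop hc
      exact Filter.tendsto_atTop_add_const_right _ _ Filter.tendsto_id
    have ht2 : Filter.Tendsto φ Filter.atTop Filter.atTop :=
      Filter.tendsto_atTop_mono' _ (Filter.eventually_ge_atTop s₀ |>.mono hlow) ht
    exact not_tendsto_nhds_of_tendsto_atTop ht2 L hL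
  have hanti : Antitone φ := antitone_of_hasDerivAt_nonpos h1 hneg
  exact hanti.le_of_tendsto hL 0

/-- the holomorphic extension and its derivatives -/
def WW {d : ℕ} {ι : Type*} (S : Finset ι) (κ : ι → Fin d → ℤ) (b : ι → ℂ) (l : ι → ℝ) (m : ℕ)
    (t s : ℝ) (x : Fin d → ℝ) : ℂ :=
  ∑ i ∈ S, b i * (Complex.I * l i) ^ m * ee (κ i) x * Complex.exp (Complex.I * l i * (t + Complex.I * s))

section WWsec
variable {d : ℕ} {ι : Type*} (S : Finset ι) (κ : ι → Fin d → ℤ) (b : ι → ℂ) (l : ι → ℝ) (m : ℕ)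

lemma WW_cont : Continuous fun p : ℝ × ℝ × (Fin d → ℝ) => WW S κ b l m p.1 p.2.1 p.2.2 := by
  unfold WW ee; fun_prop

lemma WW_per (t s : ℝ) : IsPer (WW S κ b l m t s) := by
  intro x i
  unfold WW
  refine Finset.sum_congr rfl fun j _ => ?_
  rw [ee_isPer]

lemma WW_dt (t s : ℝ) (x : Fin d → ℝ) :
    HasDerivAt (fun t => WW S κ b l m t s x) (WW S κ b l (m + 1) t s x) t := by
  unfold WW
  refine HasDerivAt.fun_sum fun i _ => ?_
  have h : HasDerivAt (fun t : ℝ => Complex.I * l i * (t + Complex.I * s)) (Complex.I * l i * 1) t :=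
    ((Complex.ofRealCLM.hasDerivAt (x := t)).add_const _).const_mul _
  convert! (h.cexp).const_mul (b i * (Complex.I * l i) ^ m * ee (κ i) x) using 1
  ring

lemma WW_ds (t s : ℝ) (x : Fin d → ℝ) :
    HasDerivAt (fun s => WW S κ b l m t s x) (Complex.I * WW S κ b l (m + 1) t s x) s := by
  unfold WW
  rw [Finset.mul_sum]
  refine HasDerivAt.fun_sum fun i _ => ?_
  have h : HasDerivAt (fun s : ℝ => Complex.I * l i * (t + Complex.I * s))
      (Complex.I * l i * (Complex.I * 1)) s :=
    (((Complex.ofRealCLM.hasDerivAt (x := s)).const_mul _).const_add _).const_mul _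
  convert! (h.cexp).const_mul (b i * (Complex.I * l i) ^ m * ee (κ i) x) using 1
  ring

lemma WW_shift (θ : Fin d → ℝ) (hl : ∀ i, l i = ∑ j, (κ i j : ℝ) * θ j) (t s : ℝ) (x : Fin d → ℝ) :
    WW S κ b l m t s x = WW S κ b l m 0 s (x + t • θ) := by
  unfold WW
  refine Finset.sum_congr rfl fun i _ => ?_
  have : ee (κ i) (t • θ) = Complex.exp (Complex.I * l i * t) := by
    unfold ee
    congr 1
    rw [hl i]
    simp only [Pi.smul_apply, smul_eq_mul]
    push_cast
    rw [mul_assoc, Finset.sum_mul]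
    congr 1
    refine Finset.sum_congr rfl fun j _ => by ring
  rw [ee_add, this, mul_add, Complex.exp_add]
  simp only [Complex.ofReal_zero, zero_add]
  ring

lemma re_dt {f : ℝ → ℂ} {f' : ℂ} {t : ℝ} (h : HasDerivAt f f' t) :
    HasDerivAt (fun t => (f t).re) f'.re t :=
  Complex.reCLM.hasFDerivAt.comp_hasDerivAt t h

lemma im_dt {f : ℝ → ℂ} {f' : ℂ} {t : ℝ} (h : HasDerivAt f f' t) :
    HasDerivAt (fun t => (f t).im) f'.im t :=
  Complex.imCLM.hasFDerivAt.comp_hasDerivAt t h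

/-- `G' = (Gu, Gv)` along curves. -/
def HasGrad (G Gu Gv : ℝ → ℝ → ℝ) : Prop :=
  ∀ (u v : ℝ → ℝ) (u' v' t : ℝ), HasDerivAt u u' t → HasDerivAt v v' t →
    HasDerivAt (fun t => G (u t) (v t)) (Gu (u t) (v t) * u' + Gv (u t) (v t) * v') t

lemma WW_decay (hl : ∀ i ∈ S, 0 < l i) (x : Fin d → ℝ) :
    Filter.Tendsto (fun s => WW S κ b l 0 0 s x) Filter.atTop (nhds 0) := by
  unfold WW
  rw [← Finset.sum_const_zero (s := S) (M := ℂ)]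
  refine tendsto_finsetSum S fun i hi => ?_
  rw [tendsto_zero_iff_norm_tendsto_zero]
  have : ∀ s : ℝ, ‖b i * (Complex.I * l i) ^ 0 * ee (κ i) x *
      Complex.exp (Complex.I * l i * ((0 : ℝ) + Complex.I * s))‖ = ‖b i‖ * Real.exp (-(l i * s)) := by
    intro s
    rw [norm_mul, norm_mul, ee_norm, Complex.norm_exp]
    simp
  simp_rw [this]
  rw [← mul_zero ‖b i‖]
  refine Filter.Tendsto.const_mul _ (Real.tendsto_exp_neg_atTop_nhds_zero.comp ?_)
  exact Filter.Tendsto.const_mul_atTop (hl i hi) Filter.tendsto_id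

lemma WW_bdd (hl : ∀ i ∈ S, 0 < l i) (x : Fin d → ℝ) (s : ℝ) (hs : 0 ≤ s) :
    ‖WW S κ b l 0 0 s x‖ ≤ ∑ i ∈ S, ‖b i‖ := by
  unfold WW
  refine norm_sum_le_of_le _ fun i hi => ?_
  rw [norm_mul, norm_mul, ee_norm, Complex.norm_exp]
  simp
  exact mul_le_of_le_one_right (norm_nonneg _) (Real.exp_le_one_iff.2 (by
    have := mul_nonneg (hl i hi).le hs; linarith))

theorem subharm (θ : Fin d → ℝ) (hl : ∀ i, l i = ∑ j, (κ i j : ℝ) * θ j) (hpos : ∀ i ∈ S, 0 < l i)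
    {G Gu Gv Guu Guv Gvv : ℝ → ℝ → ℝ}
    (hG : HasGrad G Gu Gv) (hGu : HasGrad Gu Guu Guv) (hGv : HasGrad Gv Guv Gvv)
    (c0 : Continuous G.uncurry) (cu : Continuous Gu.uncurry) (cv : Continuous Gv.uncurry)
    (cuu : Continuous Guu.uncurry) (cuv : Continuous Guv.uncurry) (cvv : Continuous Gvv.uncurry)
    (hsub : ∀ u v, 0 ≤ Guu u v + Gvv u v) :
    (∫ _ in box d, G 0 0) ≤
      ∫ x in box d, G (∑ i ∈ S, b i * ee (κ i) x).re (∑ i ∈ S, b i * ee (κ i) x).im := by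
  -- notation
  set w : ℕ → ℝ → ℝ → (Fin d → ℝ) → ℂ := WW S κ b l with hw
  have wc : ∀ m, Continuous fun p : ℝ × ℝ × (Fin d → ℝ) => w m p.1 p.2.1 p.2.2 := WW_cont S κ b l
  have comp : ∀ {H : ℝ → ℝ → ℝ}, Continuous H.uncurry →
      Continuous fun p : ℝ × ℝ × (Fin d → ℝ) => H (w 0 p.1 p.2.1 p.2.2).re (w 0 p.1 p.2.1 p.2.2).im := by
    intro H hH
    exact hH.comp ((Complex.continuous_re.comp (wc 0)).prodMk (Complex.continuous_im.comp (wc 0)))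
  have wre : ∀ m, Continuous fun p : ℝ × ℝ × (Fin d → ℝ) => (w m p.1 p.2.1 p.2.2).re :=
    fun m => Complex.continuous_re.comp (wc m)
  have wim : ∀ m, Continuous fun p : ℝ × ℝ × (Fin d → ℝ) => (w m p.1 p.2.1 p.2.2).im :=
    fun m => Complex.continuous_im.comp (wc m)
  let Φ : ℝ → ℝ → (Fin d → ℝ) → ℝ := fun t s x => G (w 0 t s x).re (w 0 t s x).im
  let Φt : ℝ → ℝ → (Fin d → ℝ) → ℝ := fun t s x =>
    Gu (w 0 t s x).re (w 0 t s x).im * (w 1 t s x).re + Gv (w 0 t s x).re (w 0 t s x).im * (w 1 t s x).im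
  let Φs : ℝ → ℝ → (Fin d → ℝ) → ℝ := fun t s x =>
    Gu (w 0 t s x).re (w 0 t s x).im * (-(w 1 t s x).im) + Gv (w 0 t s x).re (w 0 t s x).im * (w 1 t s x).re
  let Φtt : ℝ → ℝ → (Fin d → ℝ) → ℝ := fun t s x =>
    Guu (w 0 t s x).re (w 0 t s x).im * (w 1 t s x).re ^ 2
    + 2 * Guv (w 0 t s x).re (w 0 t s x).im * (w 1 t s x).re * (w 1 t s x).im
    + Gvv (w 0 t s x).re (w 0 t s x).im * (w 1 t s x).im ^ 2
    + Gu (w 0 t s x).re (w 0 t s x).im * (w 2 t s x).re + Gv (w 0 t s x).re (w 0 t s x).im * (w 2 t s x).im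
  let Φss : ℝ → ℝ → (Fin d → ℝ) → ℝ := fun t s x =>
    Guu (w 0 t s x).re (w 0 t s x).im * (w 1 t s x).im ^ 2
    - 2 * Guv (w 0 t s x).re (w 0 t s x).im * (w 1 t s x).re * (w 1 t s x).im
    + Gvv (w 0 t s x).re (w 0 t s x).im * (w 1 t s x).re ^ 2
    - Gu (w 0 t s x).re (w 0 t s x).im * (w 2 t s x).re - Gv (w 0 t s x).re (w 0 t s x).im * (w 2 t s x).im
  have cΦ : Continuous fun p : ℝ × ℝ × (Fin d → ℝ) => Φ p.1 p.2.1 p.2.2 := comp c0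
  have cΦt : Continuous fun p : ℝ × ℝ × (Fin d → ℝ) => Φt p.1 p.2.1 p.2.2 :=
    ((comp cu).mul (wre 1)).add ((comp cv).mul (wim 1))
  have cΦs : Continuous fun p : ℝ × ℝ × (Fin d → ℝ) => Φs p.1 p.2.1 p.2.2 :=
    ((comp cu).mul (wim 1).neg).add ((comp cv).mul (wre 1))
  have cΦtt : Continuous fun p : ℝ × ℝ × (Fin d → ℝ) => Φtt p.1 p.2.1 p.2.2 := by
    have a1 := comp cuu; have a2 := comp cuv; have a3 := comp cvv; have a4 := comp cu
    have a5 := comp cv; have b1 := wre 1; have b2 := wim 1; have b3 := wre 2; have b4 := wim 2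
    exact (((((a1.mul (b1.pow 2)).add (((continuous_const.mul a2).mul b1).mul b2)).add
      (a3.mul (b2.pow 2))).add (a4.mul b3)).add (a5.mul b4))
  have cΦss : Continuous fun p : ℝ × ℝ × (Fin d → ℝ) => Φss p.1 p.2.1 p.2.2 := by
    have a1 := comp cuu; have a2 := comp cuv; have a3 := comp cvv; have a4 := comp cu
    have a5 := comp cv; have b1 := wre 1; have b2 := wim 1; have b3 := wre 2; have b4 := wim 2
    exact (((((a1.mul (b2.pow 2)).sub (((continuous_const.mul a2).mul b1).mul b2)).add
      (a3.mul (b1.pow 2))).sub (a4.mul b3)).sub (a5.mul b4))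
  have wt : ∀ m t s x, HasDerivAt (fun t => w m t s x) (w (m + 1) t s x) t := WW_dt S κ b l
  have ws : ∀ m t s x, HasDerivAt (fun s => w m t s x) (Complex.I * w (m + 1) t s x) s := WW_ds S κ b l
  have dsr : ∀ m t s x, HasDerivAt (fun s => (w m t s x).re) (-(w (m + 1) t s x).im) s := by
    intro m t s x; simpa using re_dt (ws m t s x)
  have dsi : ∀ m t s x, HasDerivAt (fun s => (w m t s x).im) ((w (m + 1) t s x).re) s := by
    intro m t s x; simpa using im_dt (ws m t s x)
  have dΦt : ∀ t s x, HasDerivAt (fun t => Φ t s x) (Φt t s x) t := fun t s x =>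
    hG _ _ _ _ t (re_dt (wt 0 t s x)) (im_dt (wt 0 t s x))
  have dΦs : ∀ t s x, HasDerivAt (fun s => Φ t s x) (Φs t s x) s := fun t s x =>
    hG _ _ _ _ s (dsr 0 t s x) (dsi 0 t s x)
  have dΦtt : ∀ t s x, HasDerivAt (fun t => Φt t s x) (Φtt t s x) t := fun t s x => by
    have h := ((hGu _ _ _ _ t (re_dt (wt 0 t s x)) (im_dt (wt 0 t s x))).mul (re_dt (wt 1 t s x))).add
      ((hGv _ _ _ _ t (re_dt (wt 0 t s x)) (im_dt (wt 0 t s x))).mul (im_dt (wt 1 t s x)))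
    convert! h using 1
    simp only [Φtt]; ring
  have dΦss : ∀ t s x, HasDerivAt (fun s => Φs t s x) (Φss t s x) s := fun t s x => by
    have h := ((hGu _ _ _ _ s (dsr 0 t s x) (dsi 0 t s x)).mul (dsi 1 t s x).neg).add
      ((hGv _ _ _ _ s (dsr 0 t s x) (dsi 0 t s x)).mul (dsr 1 t s x))
    convert! h using 1
    simp only [Φss, Pi.neg_apply]; ring
  -- slices
  have slx : ∀ {H : ℝ → ℝ → (Fin d → ℝ) → ℝ},
      (Continuous fun p : ℝ × ℝ × (Fin d → ℝ) => H p.1 p.2.1 p.2.2) → ∀ t s, Continuous (H t s) :=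
    fun hH t s => hH.comp (by fun_prop : Continuous fun x : Fin d → ℝ => (t, s, x))
  have slt : ∀ {H : ℝ → ℝ → (Fin d → ℝ) → ℝ},
      (Continuous fun p : ℝ × ℝ × (Fin d → ℝ) => H p.1 p.2.1 p.2.2) →
      ∀ s, Continuous (Function.uncurry fun t x => H t s x) :=
    fun hH s => hH.comp (by fun_prop : Continuous fun p : ℝ × (Fin d → ℝ) => (p.1, s, p.2))
  have sls : ∀ {H : ℝ → ℝ → (Fin d → ℝ) → ℝ},
      (Continuous fun p : ℝ × ℝ × (Fin d → ℝ) => H p.1 p.2.1 p.2.2) →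
      ∀ t, Continuous (Function.uncurry fun s x => H t s x) :=
    fun hH t => hH.comp (by fun_prop : Continuous fun p : ℝ × (Fin d → ℝ) => (t, p.1, p.2))
  -- `∫ Φtt = 0`
  have hconst : ∀ t s, ∫ x in box d, Φ t s x = ∫ x in box d, Φ 0 s x := by
    intro t s
    have h1 : ∀ x, Φ t s x = Φ 0 s (x + t • θ) := fun x => by
      simp only [Φ, hw, WW_shift S κ b l 0 θ hl t s x]
    simp_rw [h1]
    refine integral_box_add (slx cΦ 0 s) ?_ (t • θ)
    intro x i
    simp only [Φ, hw, WW_per S κ b l 0 0 s x i]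
  have hz1 : ∀ t s, ∫ x in box d, Φt t s x = 0 := by
    intro t s
    have h := hasDerivAt_box (slt cΦ s) (slt cΦt s) (fun t x => dΦt t s x) t
    simp_rw [hconst] at h
    exact h.unique (hasDerivAt_const _ _)
  have hz2 : ∀ t s, ∫ x in box d, Φtt t s x = 0 := by
    intro t s
    have h := hasDerivAt_box (slt cΦt s) (slt cΦtt s) (fun t x => dΦtt t s x) t
    simp_rw [hz1] at h
    exact h.unique (hasDerivAt_const _ _)
  have hnn : ∀ s, 0 ≤ ∫ x in box d, Φss 0 s x := by
    intro s
    have : ∫ x in box d, Φss 0 s x = ∫ x in box d, (Φss 0 s x + Φtt 0 s x) := by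
      rw [integral_add (slx cΦss 0 s).integrable_box (slx cΦtt 0 s).integrable_box, hz2, add_zero]
    rw [this]
    refine integral_nonneg fun x => ?_
    have : Φss 0 s x + Φtt 0 s x = (Guu (w 0 0 s x).re (w 0 0 s x).im + Gvv (w 0 0 s x).re (w 0 0 s x).im)
        * ((w 1 0 s x).re ^ 2 + (w 1 0 s x).im ^ 2) := by
      simp only [Φss, Φtt]; ring
    rw [this]
    exact mul_nonneg (hsub _ _) (by positivity)
  have hlim : Filter.Tendsto (fun s => ∫ x in box d, Φ 0 s x) Filter.atTop
      (nhds (∫ _ in box d, G 0 0)) := by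
    set R := ∑ i ∈ S, ‖b i‖
    obtain ⟨M, hM⟩ := ((isCompact_Icc (a := -R) (b := R)).prod
      (isCompact_Icc (a := -R) (b := R))).exists_bound_of_continuousOn c0.continuousOn
    refine tendsto_integral_filter_of_dominated_convergence (fun _ => M)
      (Filter.Eventually.of_forall fun s => (slx cΦ 0 s).aestronglyMeasurable) ?_
      (integrable_const _) ?_
    · filter_upwards [Filter.eventually_ge_atTop 0] with s hs
      refine Filter.Eventually.of_forall fun x => ?_
      have hb := WW_bdd S κ b l hpos x s hs
      refine hM ((w 0 0 s x).re, (w 0 0 s x).im) ⟨?_, ?_⟩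
      · exact abs_le.1 ((Complex.abs_re_le_norm _).trans hb)
      · exact abs_le.1 ((Complex.abs_im_le_norm _).trans hb)
    · refine Filter.Eventually.of_forall fun x => ?_
      have h := WW_decay S κ b l hpos x
      have h2 := ((Complex.continuous_re.tendsto _).comp h).prodMk_nhds
        ((Complex.continuous_im.tendsto _).comp h)
      exact (c0.tendsto _).comp h2
  have hfin := convex_limit
    (fun s => hasDerivAt_box (sls cΦ 0) (sls cΦs 0) (fun s x => dΦs 0 s x) s)
    (fun s => hasDerivAt_box (sls cΦs 0) (sls cΦss 0) (fun s x => dΦss 0 s x) s) hnn hlim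
  refine hfin.trans (le_of_eq ?_)
  simp [Φ, hw, WW]

end WWsec



/-! ## Part C: directional Hilbert transform -/

lemma rpow_A_deriv {ε : ℝ} (hε : 0 < ε) (r : ℝ) {u : ℝ → ℝ} {u' t : ℝ}
    (hu : HasDerivAt u u' t) :
    HasDerivAt (fun t => (ε + u t ^ 2) ^ r) (2 * u t * u' * r * (ε + u t ^ 2) ^ (r - 1)) t := by
  have h := ((hu.fun_pow 2).const_add ε).rpow_const (p := r) (Or.inl (by positivity))
  convert! h using 1
  push_cast; ring

lemma rpow_B_deriv {ε : ℝ} (hε : 0 < ε) (r : ℝ) {u v : ℝ → ℝ} {u' v' t : ℝ}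
    (hu : HasDerivAt u u' t) (hv : HasDerivAt v v' t) :
    HasDerivAt (fun t => (ε + u t ^ 2 + v t ^ 2) ^ r)
      ((2 * u t * u' + 2 * v t * v') * r * (ε + u t ^ 2 + v t ^ 2) ^ (r - 1)) t := by
  have h := (((hu.fun_pow 2).const_add ε).fun_add (hv.fun_pow 2)).rpow_const (p := r)
    (Or.inl (by positivity))
  convert! h using 1
  push_cast; ring

lemma cont_A {ε : ℝ} (hε : 0 < ε) (r : ℝ) : Continuous fun p : ℝ × ℝ => (ε + p.1 ^ 2) ^ r := by
  refine Continuous.rpow_const (by fun_prop) fun p => Or.inl (by positivity)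

lemma cont_B {ε : ℝ} (hε : 0 < ε) (r : ℝ) :
    Continuous fun p : ℝ × ℝ => (ε + p.1 ^ 2 + p.2 ^ 2) ^ r := by
  refine Continuous.rpow_const (by fun_prop) fun p => Or.inl (by positivity)

section hilb
variable {d : ℕ} {ι : Type*} (S : Finset ι) (κ : ι → Fin d → ℤ) (b : ι → ℂ) (l : ι → ℝ)

lemma hilb_eps_low (θ : Fin d → ℝ) (hl : ∀ i, l i = ∑ j, (κ i j : ℝ) * θ j)
    (hpos : ∀ i ∈ S, 0 < l i) {m : ℝ} (hm : -(1 / 2) < m) (hm0 : m ≤ 0) {ε : ℝ} (hε : 0 < ε) :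
    0 ≤ ∫ x in box d, (2 / (2 * m + 1) * (ε + (∑ i ∈ S, b i * ee (κ i) x).re ^ 2) ^ (m + 1)
      - (ε + (∑ i ∈ S, b i * ee (κ i) x).re ^ 2 + (∑ i ∈ S, b i * ee (κ i) x).im ^ 2) ^ (m + 1)) := by
  set C := 2 / (2 * m + 1) with hC
  have hm1 : 0 < 2 * m + 1 := by linarith
  have hCm : C * (2 * m + 1) = 2 := by rw [hC]; field_simp
  have hC2 : 2 ≤ C := by rw [hC, le_div_iff₀ hm1]; linarith
  have h := subharm S κ b l θ hl hpos
    (G := fun u v => C * (ε + u ^ 2) ^ (m + 1) - (ε + u ^ 2 + v ^ 2) ^ (m + 1))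
    (Gu := fun u v => C * (2 * (m + 1) * u * (ε + u ^ 2) ^ m) - 2 * (m + 1) * u * (ε + u ^ 2 + v ^ 2) ^ m)
    (Gv := fun u v => -(2 * (m + 1) * v * (ε + u ^ 2 + v ^ 2) ^ m))
    (Guu := fun u v => C * (2 * (m + 1) * ((ε + u ^ 2) ^ m + 2 * m * u ^ 2 * (ε + u ^ 2) ^ (m - 1)))
      - 2 * (m + 1) * ((ε + u ^ 2 + v ^ 2) ^ m + 2 * m * u ^ 2 * (ε + u ^ 2 + v ^ 2) ^ (m - 1)))
    (Guv := fun u v => -(4 * m * (m + 1) * u * v * (ε + u ^ 2 + v ^ 2) ^ (m - 1)))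
    (Gvv := fun u v => -(2 * (m + 1) * ((ε + u ^ 2 + v ^ 2) ^ m
      + 2 * m * v ^ 2 * (ε + u ^ 2 + v ^ 2) ^ (m - 1))))
    (by
      intro u v u' v' t hu hv
      have h := ((rpow_A_deriv hε (m + 1) hu).const_mul C).fun_sub (rpow_B_deriv hε (m + 1) hu hv)
      convert! h using 1
      simp only [add_sub_cancel_right]; ring)
    (by
      intro u v u' v' t hu hv
      have h := (((hu.const_mul (2 * (m + 1))).fun_mul (rpow_A_deriv hε m hu)).const_mul C).fun_sub
        ((hu.const_mul (2 * (m + 1))).fun_mul (rpow_B_deriv hε m hu hv))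
      convert! h using 1
      ring)
    (by
      intro u v u' v' t hu hv
      have h := ((hv.const_mul (2 * (m + 1))).fun_mul (rpow_B_deriv hε m hu hv)).fun_neg
      convert! h using 1
      ring)
    (by
      have h1 := cont_A hε (m + 1); have h2 := cont_B hε (m + 1)
      unfold Function.uncurry; fun_prop)
    (by
      have h1 := cont_A hε m; have h2 := cont_B hε m
      unfold Function.uncurry; fun_prop)
    (by
      have h2 := cont_B hε m
      unfold Function.uncurry; fun_prop)
    (by
      have h1 := cont_A hε m; have h2 := cont_B hε m
      have h3 := cont_A hε (m - 1); have h4 := cont_B hε (m - 1)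
      unfold Function.uncurry; fun_prop)
    (by
      have h4 := cont_B hε (m - 1)
      unfold Function.uncurry; fun_prop)
    (by
      have h2 := cont_B hε m; have h4 := cont_B hε (m - 1)
      unfold Function.uncurry; fun_prop)
    (by
      intro u v
      have hA : 0 < ε + u ^ 2 := by positivity
      have hB : 0 < ε + u ^ 2 + v ^ 2 := by positivity
      have e1 : (ε + u ^ 2) ^ m = (ε + u ^ 2) * (ε + u ^ 2) ^ (m - 1) := by
        rw [Real.rpow_sub_one hA.ne']; field_simp
      have hX : 0 < (ε + u ^ 2) ^ (m - 1) := Real.rpow_pos_of_pos hA _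
      have hY : 0 < (ε + u ^ 2 + v ^ 2) ^ (m - 1) := Real.rpow_pos_of_pos hB _
      have hle : (ε + u ^ 2 + v ^ 2) ^ m ≤ (ε + u ^ 2) ^ m :=
        Real.rpow_le_rpow_of_nonpos hA (by nlinarith [sq_nonneg v]) hm0
      have k1 : (2 * m + 1) * (ε + u ^ 2) ^ m ≤ (ε + u ^ 2) ^ m + 2 * m * u ^ 2 * (ε + u ^ 2) ^ (m - 1) := by
        rw [e1]
        nlinarith [mul_nonneg (mul_nonneg hε.le hX.le) (neg_nonneg.2 hm0)]
      have k2 : 2 * (ε + u ^ 2) ^ m ≤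
          C * ((ε + u ^ 2) ^ m + 2 * m * u ^ 2 * (ε + u ^ 2) ^ (m - 1)) := by
        calc _ = C * ((2 * m + 1) * (ε + u ^ 2) ^ m) := by rw [← mul_assoc, hCm]
          _ ≤ _ := mul_le_mul_of_nonneg_left k1 (by linarith)
      have k3 : 2 * m * (u ^ 2 + v ^ 2) * (ε + u ^ 2 + v ^ 2) ^ (m - 1) ≤ 0 := by
        have : 0 ≤ (u ^ 2 + v ^ 2) * (ε + u ^ 2 + v ^ 2) ^ (m - 1) := by positivity
        nlinarith
      have k4 : 0 ≤ C * ((ε + u ^ 2) ^ m + 2 * m * u ^ 2 * (ε + u ^ 2) ^ (m - 1))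
        - (2 * (ε + u ^ 2 + v ^ 2) ^ m + 2 * m * (u ^ 2 + v ^ 2) * (ε + u ^ 2 + v ^ 2) ^ (m - 1)) := by
        linarith
      have := mul_nonneg (by linarith : 0 ≤ 2 * (m + 1)) k4
      refine this.trans (le_of_eq (by ring)))
  refine le_trans (integral_nonneg fun _ => ?_) h
  have : 0 ≤ (C - 1) * ε ^ (m + 1) := mul_nonneg (by linarith) (Real.rpow_nonneg hε.le _)
  simpa [sub_mul] using this

lemma hilb_eps_high (θ : Fin d → ℝ) (hl : ∀ i, l i = ∑ j, (κ i j : ℝ) * θ j)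
    (hpos : ∀ i ∈ S, 0 < l i) {m : ℝ} (hm0 : 0 ≤ m) {ε : ℝ} (hε : 0 < ε) :
    (∫ _ in box d, -(ε ^ (m + 1))) ≤ ∫ x in box d,
      (2 * (m + 1) ^ 2 * (∑ i ∈ S, b i * ee (κ i) x).re ^ 2 *
        (ε + (∑ i ∈ S, b i * ee (κ i) x).re ^ 2 + (∑ i ∈ S, b i * ee (κ i) x).im ^ 2) ^ m
      - (ε + (∑ i ∈ S, b i * ee (κ i) x).re ^ 2 + (∑ i ∈ S, b i * ee (κ i) x).im ^ 2) ^ (m + 1)) := by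
  set C := 2 * (m + 1) ^ 2 with hC
  have h := subharm S κ b l θ hl hpos
    (G := fun u v => C * u ^ 2 * (ε + u ^ 2 + v ^ 2) ^ m - (ε + u ^ 2 + v ^ 2) ^ (m + 1))
    (Gu := fun u v => C * (2 * u * (ε + u ^ 2 + v ^ 2) ^ m + 2 * m * u ^ 3 * (ε + u ^ 2 + v ^ 2) ^ (m - 1))
      - 2 * (m + 1) * u * (ε + u ^ 2 + v ^ 2) ^ m)
    (Gv := fun u v => C * (2 * m * u ^ 2 * v * (ε + u ^ 2 + v ^ 2) ^ (m - 1))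
      - 2 * (m + 1) * v * (ε + u ^ 2 + v ^ 2) ^ m)
    (Guu := fun u v => C * (2 * (ε + u ^ 2 + v ^ 2) ^ m + 10 * m * u ^ 2 * (ε + u ^ 2 + v ^ 2) ^ (m - 1)
        + 4 * m * (m - 1) * u ^ 4 * (ε + u ^ 2 + v ^ 2) ^ (m - 1 - 1))
      - 2 * (m + 1) * ((ε + u ^ 2 + v ^ 2) ^ m + 2 * m * u ^ 2 * (ε + u ^ 2 + v ^ 2) ^ (m - 1)))
    (Guv := fun u v => C * (4 * m * u * v * (ε + u ^ 2 + v ^ 2) ^ (m - 1)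
        + 4 * m * (m - 1) * u ^ 3 * v * (ε + u ^ 2 + v ^ 2) ^ (m - 1 - 1))
      - 4 * m * (m + 1) * u * v * (ε + u ^ 2 + v ^ 2) ^ (m - 1))
    (Gvv := fun u v => C * u ^ 2 * (2 * m * (ε + u ^ 2 + v ^ 2) ^ (m - 1)
        + 4 * m * (m - 1) * v ^ 2 * (ε + u ^ 2 + v ^ 2) ^ (m - 1 - 1))
      - 2 * (m + 1) * ((ε + u ^ 2 + v ^ 2) ^ m + 2 * m * v ^ 2 * (ε + u ^ 2 + v ^ 2) ^ (m - 1)))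
    (by
      intro u v u' v' t hu hv
      have h := (((hu.fun_pow 2).const_mul C).fun_mul (rpow_B_deriv hε m hu hv)).fun_sub
        (rpow_B_deriv hε (m + 1) hu hv)
      convert! h using 1
      simp only [add_sub_cancel_right]; push_cast; ring)
    (by
      intro u v u' v' t hu hv
      have h := ((((hu.const_mul 2).fun_mul (rpow_B_deriv hε m hu hv)).fun_add
        (((hu.fun_pow 3).const_mul (2 * m)).fun_mul (rpow_B_deriv hε (m - 1) hu hv))).const_mul C).fun_sub
        ((hu.const_mul (2 * (m + 1))).fun_mul (rpow_B_deriv hε m hu hv))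
      convert! h using 1
      push_cast; ring)
    (by
      intro u v u' v' t hu hv
      have h := (((((hu.fun_pow 2).const_mul (2 * m)).fun_mul hv).fun_mul
        (rpow_B_deriv hε (m - 1) hu hv)).const_mul C).fun_sub
        ((hv.const_mul (2 * (m + 1))).fun_mul (rpow_B_deriv hε m hu hv))
      convert! h using 1
      push_cast; ring)
    (by
      have h1 := cont_B hε m; have h2 := cont_B hε (m + 1)
      unfold Function.uncurry; fun_prop)
    (by
      have h1 := cont_B hε m; have h2 := cont_B hε (m - 1)
      unfold Function.uncurry; fun_prop)
    (by
      have h1 := cont_B hε m; have h2 := cont_B hε (m - 1)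
      unfold Function.uncurry; fun_prop)
    (by
      have h1 := cont_B hε m; have h2 := cont_B hε (m - 1); have h3 := cont_B hε (m - 1 - 1)
      unfold Function.uncurry; fun_prop)
    (by
      have h2 := cont_B hε (m - 1); have h3 := cont_B hε (m - 1 - 1)
      unfold Function.uncurry; fun_prop)
    (by
      have h1 := cont_B hε m; have h2 := cont_B hε (m - 1); have h3 := cont_B hε (m - 1 - 1)
      unfold Function.uncurry; fun_prop)
    (by
      intro u v
      have hB : 0 < ε + u ^ 2 + v ^ 2 := by positivity
      set B := ε + u ^ 2 + v ^ 2 with hBdef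
      have hX : 0 < B ^ (m - 1 - 1) := Real.rpow_pos_of_pos hB _
      have e1 : B ^ (m - 1) = B * B ^ (m - 1 - 1) := by
        rw [Real.rpow_sub_one hB.ne' (m - 1)]; field_simp
      have e0 : B ^ m = B ^ 2 * B ^ (m - 1 - 1) := by
        rw [Real.rpow_sub_one hB.ne' (m - 1), Real.rpow_sub_one hB.ne' m]; field_simp
      rw [e0, e1]
      set X := B ^ (m - 1 - 1)
      have hN : u ^ 2 + v ^ 2 ≤ B := by rw [hBdef]; linarith
      have key : 0 ≤ C * (2 * B ^ 2 + 12 * m * u ^ 2 * B + 4 * m * (m - 1) * u ^ 2 * (u ^ 2 + v ^ 2))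
          - 2 * (m + 1) * (2 * B ^ 2 + 2 * m * (u ^ 2 + v ^ 2) * B) := by
        have k1 : 0 ≤ 12 * m * u ^ 2 * B + 4 * m * (m - 1) * u ^ 2 * (u ^ 2 + v ^ 2) := by
          have : 12 * m * u ^ 2 * B + 4 * m * (m - 1) * u ^ 2 * (u ^ 2 + v ^ 2)
            = 4 * m ^ 2 * u ^ 2 * (u ^ 2 + v ^ 2) + 4 * m * u ^ 2 * (B - (u ^ 2 + v ^ 2))
              + 8 * m * u ^ 2 * B := by ring
          rw [this]
          have := sub_nonneg.2 hN
          positivity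
        have k2 : 2 * m * (u ^ 2 + v ^ 2) * B ≤ 2 * m * B * B := by
          gcongr
        have k3 : 0 ≤ C := by rw [hC]; positivity
        have k4 := mul_nonneg k3 k1
        have k5 := mul_le_mul_of_nonneg_left k2 (by linarith : 0 ≤ 2 * (m + 1))
        have : C * (2 * B ^ 2) = 2 * (m + 1) * (2 * B ^ 2) + 2 * (m + 1) * (2 * m * B * B) := by
          rw [hC]; ring
        linarith
      refine (mul_nonneg key hX.le).trans (le_of_eq (by ring)))
  simpa using h

/-- abbreviation: the L^q-integral on the box -/
def II {d : ℕ} (q : ℝ) (f : (Fin d → ℝ) → ℝ) : ℝ := ∫ x in box d, |f x| ^ q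

lemma sq_rpow_half (q u : ℝ) : (u ^ 2) ^ (q / 2) = |u| ^ q := by
  rw [← sq_abs, ← Real.rpow_natCast, ← Real.rpow_mul (abs_nonneg u)]
  congr 1; push_cast; ring

lemma abs_im_le (z : ℂ) {q : ℝ} (hq : 0 ≤ q) : |z.im| ^ q ≤ (z.re ^ 2 + z.im ^ 2) ^ (q / 2) := by
  rw [← sq_rpow_half]
  exact Real.rpow_le_rpow (sq_nonneg _) (by nlinarith [sq_nonneg z.re]) (by linarith)

theorem hilb_pos {q : ℝ} (hq : 1 < q) : ∃ C : ℝ, 0 < C ∧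
    ∀ {d : ℕ} {ι : Type} (S : Finset ι) (κ : ι → Fin d → ℤ) (b : ι → ℂ) (θ : Fin d → ℝ),
    (∀ i ∈ S, 0 < ∑ j, (κ i j : ℝ) * θ j) →
    II q (fun x => (∑ i ∈ S, b i * ee (κ i) x).im) ≤ C * II q (fun x => (∑ i ∈ S, b i * ee (κ i) x).re) := by
  have fcont : ∀ {d : ℕ} {ι : Type} (S : Finset ι) (κ : ι → Fin d → ℤ) (b : ι → ℂ),
      Continuous fun x => ∑ i ∈ S, b i * ee (κ i) x := by
    intro d ι S κ b; unfold ee; fun_prop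
  have hq2 : 0 < q / 2 := by linarith
  rcases le_total q 2 with h2 | h2
  · refine ⟨2 / (2 * (q / 2 - 1) + 1), div_pos two_pos (by linarith), ?_⟩
    intro d ι S κ b θ hpos
    set C := 2 / (2 * (q / 2 - 1) + 1)
    set F := fun x : Fin d → ℝ => ∑ i ∈ S, b i * ee (κ i) x with hF
    have hFc : Continuous F := fcont S κ b
    have hcont : Continuous fun ε : ℝ => ∫ x in box d, (C * (ε + (F x).re ^ 2) ^ (q / 2)
      - (ε + (F x).re ^ 2 + (F x).im ^ 2) ^ (q / 2)) := by
      refine continuous_box_param ?_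
      unfold Function.uncurry
      refine (continuous_const.mul (Continuous.rpow_const ?_ fun _ => Or.inr hq2.le)).sub
        (Continuous.rpow_const ?_ fun _ => Or.inr hq2.le) <;> fun_prop
    have h0 : 0 ≤ ∫ x in box d, (C * (0 + (F x).re ^ 2) ^ (q / 2)
      - (0 + (F x).re ^ 2 + (F x).im ^ 2) ^ (q / 2)) := by
      refine ge_of_tendsto ((hcont.tendsto 0).mono_left (nhdsWithin_le_nhds (s := Set.Ioi 0))) ?_
      filter_upwards [self_mem_nhdsWithin] with ε hε
      have := hilb_eps_low S κ b (fun i => ∑ j, (κ i j : ℝ) * θ j) θ (fun _ => rfl) hpos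
        (m := q / 2 - 1) (by linarith) (by linarith) hε
      rw [sub_add_cancel] at this
      exact this
    simp only [zero_add, sq_rpow_half] at h0
    have c1 : Continuous fun x => |(F x).re| ^ q :=
      Continuous.rpow_const (by fun_prop) fun _ => Or.inr (by linarith)
    have c2 : Continuous fun x => ((F x).re ^ 2 + (F x).im ^ 2) ^ (q / 2) :=
      Continuous.rpow_const (by fun_prop) fun _ => Or.inr (by linarith)
    have c3 : Continuous fun x => |(F x).im| ^ q :=
      Continuous.rpow_const (by fun_prop) fun _ => Or.inr (by linarith)
    rw [integral_sub (c1.integrable_box.const_mul C) c2.integrable_box, integral_const_mul] at h0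
    have h3 : II q (fun x => (F x).im) ≤ ∫ x in box d, ((F x).re ^ 2 + (F x).im ^ 2) ^ (q / 2) :=
      integral_mono c3.integrable_box c2.integrable_box fun x => abs_im_le (F x) (by linarith)
    change _ ≤ C * ∫ x in box d, |(F x).re| ^ q
    linarith
  · set m := q / 2 - 1 with hm
    have hm0 : 0 ≤ m := by linarith
    have hm1 : m + 1 = q / 2 := by rw [hm]; ring
    set C := 2 * (m + 1) ^ 2 with hC
    have hCpos : 0 < C := by positivity
    refine ⟨2 * (C * (2 * C) ^ m), by positivity, ?_⟩
    intro d ι S κ b θ hpos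
    set F := fun x : Fin d → ℝ => ∑ i ∈ S, b i * ee (κ i) x with hF
    have hFc : Continuous F := fcont S κ b
    have hcont : Continuous fun ε : ℝ => ∫ x in box d, (C * (F x).re ^ 2 *
        (ε + (F x).re ^ 2 + (F x).im ^ 2) ^ m
      - (ε + (F x).re ^ 2 + (F x).im ^ 2) ^ (m + 1)) := by
      refine continuous_box_param ?_
      unfold Function.uncurry
      refine (Continuous.mul (by fun_prop) (Continuous.rpow_const ?_ fun _ => Or.inr hm0)).sub
        (Continuous.rpow_const ?_ fun _ => Or.inr (by linarith)) <;> fun_prop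
    have hcont2 : Continuous fun ε : ℝ => ∫ _ in box d, -(ε ^ (m + 1)) := by
      refine continuous_box_param ?_
      unfold Function.uncurry
      exact (Continuous.rpow_const (by fun_prop) fun _ => Or.inr (by linarith)).neg
    have h0 := le_of_tendsto_of_tendsto
      ((hcont2.tendsto 0).mono_left (nhdsWithin_le_nhds (s := Set.Ioi 0)))
      ((hcont.tendsto 0).mono_left (nhdsWithin_le_nhds (s := Set.Ioi 0))) (by
        filter_upwards [self_mem_nhdsWithin] with ε hε
        exact hilb_eps_high S κ b (fun i => ∑ j, (κ i j : ℝ) * θ j) θ (fun _ => rfl) hpos hm0 hε)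
    rw [Real.zero_rpow (by linarith)] at h0
    simp only [zero_add, neg_zero, integral_zero] at h0
    have c1 : Continuous fun x => |(F x).re| ^ q :=
      Continuous.rpow_const (by fun_prop) fun _ => Or.inr (by linarith)
    have c2 : Continuous fun x => ((F x).re ^ 2 + (F x).im ^ 2) ^ (q / 2) :=
      Continuous.rpow_const (by fun_prop) fun _ => Or.inr (by linarith)
    have c3 : Continuous fun x => |(F x).im| ^ q :=
      Continuous.rpow_const (by fun_prop) fun _ => Or.inr (by linarith)
    have c4 : Continuous fun x => C * (F x).re ^ 2 * ((F x).re ^ 2 + (F x).im ^ 2) ^ m :=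
      Continuous.mul (by fun_prop) (Continuous.rpow_const (by fun_prop) fun _ => Or.inr hm0)
    have young : ∀ u N : ℝ, 0 ≤ N → C * u ^ 2 * N ^ m ≤ 1 / 2 * N ^ (q / 2) + C * (2 * C) ^ m * |u| ^ q := by
      intro u N hN
      have hA : 0 ≤ N ^ (q / 2) := Real.rpow_nonneg hN _
      have hB : 0 ≤ C * (2 * C) ^ m * |u| ^ q := by positivity
      rcases le_total (2 * C * u ^ 2) N with h | h
      · have e : N ^ (q / 2) = N * N ^ m := by
          rw [← hm1, Real.rpow_add_one' hN (by linarith), mul_comm]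
        have : 2 * C * u ^ 2 * N ^ m ≤ N * N ^ m := mul_le_mul_of_nonneg_right h (Real.rpow_nonneg hN _)
        rw [← e] at this
        linarith
      · have h1 : N ^ m ≤ (2 * C) ^ m * (u ^ 2) ^ m := by
          rw [← Real.mul_rpow (by positivity) (by positivity)]
          exact Real.rpow_le_rpow hN h hm0
        have e : |u| ^ q = u ^ 2 * (u ^ 2) ^ m := by
          rw [← sq_rpow_half, ← hm1, Real.rpow_add_one' (sq_nonneg _) (by linarith), mul_comm]
        have h2 := mul_le_mul_of_nonneg_left h1 (by positivity : 0 ≤ C * u ^ 2)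
        rw [e]
        nlinarith
    rw [integral_sub c4.integrable_box (by rw [hm1]; exact c2.integrable_box), hm1] at h0
    have h3 : II q (fun x => (F x).im) ≤ ∫ x in box d, ((F x).re ^ 2 + (F x).im ^ 2) ^ (q / 2) :=
      integral_mono c3.integrable_box c2.integrable_box fun x => abs_im_le (F x) (by linarith)
    have h4 : ∫ x in box d, C * (F x).re ^ 2 * ((F x).re ^ 2 + (F x).im ^ 2) ^ m ≤
        ∫ x in box d, (1 / 2 * ((F x).re ^ 2 + (F x).im ^ 2) ^ (q / 2)
          + C * (2 * C) ^ m * |(F x).re| ^ q) :=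
      integral_mono c4.integrable_box
        ((c2.integrable_box.const_mul _).add (c1.integrable_box.const_mul _))
        fun x => young _ _ (by positivity)
    rw [integral_add (c2.integrable_box.const_mul _) (c1.integrable_box.const_mul _),
      integral_const_mul, integral_const_mul] at h4
    change _ ≤ 2 * (C * (2 * C) ^ m) * ∫ x in box d, |(F x).re| ^ q
    linarith

end hilb

/-- real trigonometric polynomial -/
def TR {d : ℕ} (S : Finset (Fin d → ℤ)) (a : (Fin d → ℤ) → ℂ) (x : Fin d → ℝ) : ℝ :=
  (∑ k ∈ S, a k * ee k x).re

lemma TR_cont {d : ℕ} (S : Finset (Fin d → ℤ)) (a : (Fin d → ℤ) → ℂ) : Continuous (TR S a) := by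
  unfold TR ee; fun_prop

theorem hilb {q : ℝ} (hq : 1 < q) : ∃ C : ℝ, 0 < C ∧
    ∀ {d : ℕ} (S : Finset (Fin d → ℤ)) (a : (Fin d → ℤ) → ℂ) (θ : Fin d → ℝ),
    (∀ k ∈ S, ∑ j, (k j : ℝ) * θ j ≠ 0) →
    II q (TR S fun k => -Complex.I * (Real.sign (∑ j, (k j : ℝ) * θ j) : ℝ) * a k) ≤ C * II q (TR S a) := by
  obtain ⟨C, hC, h⟩ := hilb_pos hq
  refine ⟨C, hC, ?_⟩
  intro d S a θ hne
  classical
  let P : (Fin d → ℤ) → Prop := fun k => 0 < ∑ j, (k j : ℝ) * θ j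
  have key := h S (fun k => if P k then k else -k)
    (fun k => if P k then a k else (starRingEnd ℂ) (a k)) θ (by
      intro k hk
      by_cases hp : P k
      · simp only [hp, if_true]; exact hp
      · simp only [hp, if_false]
        have := lt_of_le_of_ne (not_lt.1 hp) (hne k hk)
        simp only [Pi.neg_apply, Int.cast_neg, neg_mul, Finset.sum_neg_distrib]
        linarith)
  have e : ∀ x k, (if P k then a k else (starRingEnd ℂ) (a k)) * ee (if P k then k else -k) x
      = if P k then a k * ee k x else (starRingEnd ℂ) (a k * ee k x) := by
    intro x k
    by_cases hp : P k
    · simp [hp]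
    · simp [hp, ee_conj]
  simp_rw [e] at key
  have e1 : (fun x => (∑ i ∈ S, if P i then a i * ee i x else (starRingEnd ℂ) (a i * ee i x)).re) = TR S a := by
    funext x
    unfold TR
    rw [Complex.re_sum, Complex.re_sum]
    refine Finset.sum_congr rfl fun k _ => ?_
    by_cases hp : P k
    · simp [hp]
    · simp [hp]
  have e2 : (fun x => (∑ i ∈ S, if P i then a i * ee i x else (starRingEnd ℂ) (a i * ee i x)).im)
      = TR S fun k => -Complex.I * (Real.sign (∑ j, (k j : ℝ) * θ j) : ℝ) * a k := by
    funext x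
    unfold TR
    rw [Complex.re_sum, Complex.im_sum]
    refine Finset.sum_congr rfl fun k hk => ?_
    beta_reduce
    by_cases hp : P k
    · rw [Real.sign_of_pos hp]; simp [hp]
    · rw [Real.sign_of_neg (lt_of_le_of_ne (not_lt.1 hp) (hne k hk))]; simp [hp]; ring
  rw [e1, e2] at key
  exact key



/-! ## Part D: Riesz transforms by the method of rotations -/

lemma measurable_sign_real : Measurable Real.sign := by
  unfold Real.sign
  exact Measurable.ite measurableSet_Iio measurable_const
    (Measurable.ite measurableSet_Ioi measurable_const measurable_const)

lemma abs_sign_le (x : ℝ) : |Real.sign x| ≤ 1 := by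
  rcases Real.sign_apply_eq x with h | h | h <;> rw [h] <;> norm_num

section rot
variable {E : Type*} [NormedAddCommGroup E] [InnerProductSpace ℝ E] [FiniteDimensional ℝ E]
  [MeasurableSpace E] [BorelSpace E]

def MM (v : E) : E := ∫ θ in Metric.ball (0 : E) 1, Real.sign (inner ℝ v θ) • θ

lemma MM_int (v : E) : IntegrableOn (fun θ : E => Real.sign (inner ℝ v θ) • θ) (Metric.ball (0 : E) 1) := by
  refine Measure.integrableOn_of_bounded (M := 1) measure_ball_lt_top.ne ?_ ?_
  · exact ((measurable_sign_real.comp (by fun_prop)).smul measurable_id).aestronglyMeasurable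
  · filter_upwards [ae_restrict_mem measurableSet_ball] with θ hθ
    rw [norm_smul, Real.norm_eq_abs]
    have := abs_sign_le (inner ℝ v θ)
    have h2 : ‖θ‖ < 1 := by simpa using hθ
    nlinarith [abs_nonneg (Real.sign (inner ℝ v θ)), norm_nonneg θ]

lemma MM_map (T : E ≃ₗᵢ[ℝ] E) (v : E) : MM (T v) = T (MM v) := by
  unfold MM
  have h := T.measurePreserving.setIntegral_preimage_emb T.toHomeomorph.measurableEmbedding
    (fun θ : E => Real.sign (inner ℝ (T v) θ) • θ) (Metric.ball 0 1)
  rw [← h]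
  have hb : T ⁻¹' Metric.ball 0 1 = Metric.ball (0 : E) 1 := by
    ext x; simp
  rw [hb]
  simp only [LinearIsometryEquiv.inner_map_map]
  have := T.toContinuousLinearEquiv.toContinuousLinearMap.integral_comp_comm (MM_int v)
  simpa using this

lemma MM_smul {r : ℝ} (hr : 0 < r) (v : E) : MM (r • v) = MM v := by
  unfold MM
  congr 1
  funext θ
  rw [real_inner_smul_left]
  congr 1
  rcases lt_trichotomy (inner ℝ v θ : ℝ) 0 with h | h | h
  · rw [Real.sign_of_neg h, Real.sign_of_neg (mul_neg_of_pos_of_neg hr h)]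
  · rw [h, mul_zero]
  · rw [Real.sign_of_pos h, Real.sign_of_pos (mul_pos hr h)]

lemma MM_inner (v : E) : inner ℝ v (MM v) = ∫ θ in Metric.ball (0 : E) 1, |(inner ℝ v θ : ℝ)| := by
  have := (innerSL ℝ v).integral_comp_comm (MM_int v)
  simp only [innerSL_apply_apply] at this
  rw [MM, ← this]
  congr 1
  funext θ
  rw [real_inner_smul_right]
  rcases lt_trichotomy (inner ℝ v θ : ℝ) 0 with h | h | h
  · rw [Real.sign_of_neg h, abs_of_neg h]; ring
  · rw [h]; simp
  · rw [Real.sign_of_pos h, abs_of_pos h]; ring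

lemma MM_pos {v : E} (hv : v ≠ 0) : 0 < inner ℝ v (MM v) := by
  rw [MM_inner]
  have hc : Continuous fun θ : E => |(inner ℝ v θ : ℝ)| := by fun_prop
  have hi : IntegrableOn (fun θ : E => |(inner ℝ v θ : ℝ)|) (Metric.ball (0 : E) 1) :=
    (hc.continuousOn.integrableOn_compact (isCompact_closedBall (0 : E) 1)).mono_set
      Metric.ball_subset_closedBall
  rw [setIntegral_pos_iff_support_of_nonneg_ae (Filter.Eventually.of_forall fun _ => abs_nonneg _) hi]
  refine IsOpen.measure_pos _ (IsOpen.inter (hc.isOpen_support) Metric.isOpen_ball) ?_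
  have hn : 0 < ‖v‖ := norm_pos_iff.2 hv
  refine ⟨(2 * ‖v‖)⁻¹ • v, ?_, ?_⟩
  · rw [Function.mem_support, real_inner_smul_right, real_inner_self_eq_norm_sq]
    positivity
  · rw [mem_ball_zero_iff, norm_smul, Real.norm_of_nonneg (by positivity)]
    field_simp
    norm_num

lemma MM_mem (v : E) : ∃ t : ℝ, MM v = t • v := by
  have h := MM_map (Submodule.span ℝ {v}).reflection v
  rw [Submodule.reflection_mem_subspace_eq_self (Submodule.mem_span_singleton_self v)] at h
  have h2 := (Submodule.reflection_eq_self_iff (K := Submodule.span ℝ {v}) (MM v)).1 h.symm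
  obtain ⟨t, ht⟩ := Submodule.mem_span_singleton.1 h2
  exact ⟨t, ht.symm⟩

lemma MM_eq : ∃ c : ℝ, 0 < c ∧ ∀ v : E, v ≠ 0 → MM v = (c / ‖v‖) • v := by
  by_cases hE : ∃ e : E, ‖e‖ = 1
  · obtain ⟨e, he⟩ := hE
    have he0 : e ≠ 0 := by rintro rfl; simp at he
    refine ⟨inner ℝ e (MM e), MM_pos he0, fun v hv => ?_⟩
    have hn : 0 < ‖v‖ := norm_pos_iff.2 hv
    set w : E := ‖v‖⁻¹ • v with hw
    have hw1 : ‖w‖ = 1 := by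
      rw [hw, norm_smul, norm_inv, norm_norm]; field_simp
    have h1 : MM v = MM w := (MM_smul (by positivity) v).symm
    have h2 : inner ℝ w (MM w) = inner ℝ e (MM e) := by
      have hT := Submodule.reflection_sub (F := E) (v := e) (w := w) (by rw [he, hw1])
      rw [← hT, MM_map, LinearIsometryEquiv.inner_map_map]
    obtain ⟨t, ht⟩ := MM_mem w
    rw [ht, real_inner_smul_right, real_inner_self_eq_norm_sq, hw1] at h2
    rw [h1, ht, ← h2, hw, smul_smul]
    congr 1
    field_simp
  · refine ⟨1, one_pos, fun v hv => absurd ⟨‖v‖⁻¹ • v, ?_⟩ hE⟩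
    have hn : 0 < ‖v‖ := norm_pos_iff.2 hv
    rw [norm_smul, norm_inv, norm_norm]; field_simp

end rot


lemma jensen_fin {α : Type*} [MeasurableSpace α] (μ : Measure α) [IsFiniteMeasure μ] {q : ℝ} (hq : 1 < q)
    {g : α → ℝ} (h0 : ∀ x, 0 ≤ g x) (hi : Integrable g μ) (hi2 : Integrable (fun x => g x ^ q) μ) :
    (∫ x, g x ∂μ) ^ q ≤ (μ.real Set.univ ^ q * (μ.real Set.univ)⁻¹) * ∫ x, g x ^ q ∂μ := by
  rcases eq_or_ne μ 0 with rfl | hne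
  · simp [Real.zero_rpow (show q ≠ 0 by linarith)]
  have : NeZero μ := ⟨hne⟩
  have hm : 0 < μ.real Set.univ := by
    rw [measureReal_def]
    exact ENNReal.toReal_pos (by simpa using hne) (measure_ne_top _ _)
  have h := (convexOn_rpow hq.le).map_average_le (μ := μ) (f := g)
    (by
      refine ContinuousOn.rpow_const continuousOn_id fun x _ => Or.inr (by linarith))
    isClosed_Ici (Filter.Eventually.of_forall fun x => h0 x) hi hi2
  rw [average_eq, average_eq, smul_eq_mul, smul_eq_mul,
    Real.mul_rpow (by positivity) (integral_nonneg h0), Real.inv_rpow hm.le] at h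
  have hp : 0 < μ.real Set.univ ^ q := by positivity
  calc (∫ x, g x ∂μ) ^ q = μ.real Set.univ ^ q * ((μ.real Set.univ ^ q)⁻¹ * (∫ x, g x ∂μ) ^ q) := by
        field_simp
    _ ≤ μ.real Set.univ ^ q * ((μ.real Set.univ)⁻¹ * ∫ x, g x ^ q ∂μ) := by gcongr
    _ = _ := by ring

/-- integer frequency as a Euclidean vector -/
def kk {d : ℕ} (k : Fin d → ℤ) : EuclideanSpace ℝ (Fin d) := WithLp.toLp 2 fun j => (k j : ℝ)

lemma kk_inner {d : ℕ} (k : Fin d → ℤ) (θ : EuclideanSpace ℝ (Fin d)) :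
    (inner ℝ (kk k) θ : ℝ) = ∑ j, (k j : ℝ) * θ j := by
  simp [kk, PiLp.inner_apply, mul_comm]

lemma kk_ne {d : ℕ} {k : Fin d → ℤ} (hk : k ≠ 0) : kk k ≠ 0 := by
  intro h
  apply hk
  funext j
  have := congrArg (fun v : EuclideanSpace ℝ (Fin d) => v j) h
  simpa [kk] using this

def RR {d : ℕ} (j : Fin d) (a : (Fin d → ℤ) → ℂ) (k : Fin d → ℤ) : ℂ :=
  -Complex.I * (((k j : ℝ) / ‖kk k‖ : ℝ) : ℂ) * a k

lemma TR_real {d : ℕ} (S : Finset (Fin d → ℤ)) (a : (Fin d → ℤ) → ℂ) (s : (Fin d → ℤ) → ℝ)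
    (x : Fin d → ℝ) :
    TR S (fun k => -Complex.I * (s k : ℂ) * a k) x = ∑ k ∈ S, s k * (-Complex.I * a k * ee k x).re := by
  unfold TR
  rw [Complex.re_sum]
  refine Finset.sum_congr rfl fun k _ => ?_
  rw [← Complex.re_ofReal_mul]
  congr 1
  ring

lemma hyper_null {d : ℕ} {k : Fin d → ℤ} (hk : k ≠ 0) :
    ∀ᵐ θ : EuclideanSpace ℝ (Fin d), ∑ j, (k j : ℝ) * θ j ≠ 0 := by
  have h := Measure.addHaar_submodule (volume : Measure (EuclideanSpace ℝ (Fin d)))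
    (LinearMap.ker (innerSL ℝ (kk k)).toLinearMap) (by
      intro h
      have : kk k ∈ LinearMap.ker (innerSL ℝ (kk k)).toLinearMap := by rw [h]; trivial
      simp at this
      exact kk_ne hk this)
  rw [ae_iff]
  convert! h using 2
  ext θ
  simp only [not_not, Set.mem_ofPred_eq, SetLike.mem_coe, LinearMap.mem_ker]
  rw [← kk_inner]
  rfl

lemma riesz_rep {d : ℕ} : ∃ c : ℝ, 0 < c ∧ ∀ (S : Finset (Fin d → ℤ)) (a : (Fin d → ℤ) → ℂ) (j : Fin d),
    0 ∉ S → ∀ x, c * TR S (RR j a) x = ∫ θ in Metric.ball (0 : EuclideanSpace ℝ (Fin d)) 1,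
      θ j * TR S (fun k => -Complex.I * (Real.sign (∑ j, (k j : ℝ) * θ j) : ℝ) * a k) x := by
  obtain ⟨c, hc, h⟩ := MM_eq (E := EuclideanSpace ℝ (Fin d))
  refine ⟨c, hc, fun S a j hS x => ?_⟩
  have e1 : TR S (RR j a) x = ∑ k ∈ S, ((k j : ℝ) / ‖kk k‖) * (-Complex.I * a k * ee k x).re :=
    TR_real S a (fun k => (k j : ℝ) / ‖kk k‖) x
  have hint : ∀ k : Fin d → ℤ, Integrable (fun θ : EuclideanSpace ℝ (Fin d) =>
      (Real.sign (inner ℝ (kk k) θ) • θ) j) (volume.restrict (Metric.ball 0 1)) := fun k =>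
    (EuclideanSpace.proj (𝕜 := ℝ) j).integrable_comp (MM_int (kk k))
  have hval : ∀ k ∈ S, ∫ θ in Metric.ball (0 : EuclideanSpace ℝ (Fin d)) 1,
      (Real.sign (inner ℝ (kk k) θ) • θ) j = c / ‖kk k‖ * k j := by
    intro k hk
    have h1 := (EuclideanSpace.proj (𝕜 := ℝ) j).integral_comp_comm (MM_int (kk k))
    have h2 := h (kk k) (kk_ne (by rintro rfl; exact hS hk))
    change _ = (EuclideanSpace.proj (𝕜 := ℝ) j) (MM (kk k)) at h1
    rw [h2] at h1
    exact h1
  have e2 : ∀ θ : EuclideanSpace ℝ (Fin d),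
      θ j * TR S (fun k => -Complex.I * (Real.sign (∑ j, (k j : ℝ) * θ j) : ℝ) * a k) x
      = ∑ k ∈ S, (Real.sign (inner ℝ (kk k) θ) • θ) j * (-Complex.I * a k * ee k x).re := by
    intro θ
    rw [TR_real S a (fun k => Real.sign (∑ j, (k j : ℝ) * θ j)), Finset.mul_sum]
    refine Finset.sum_congr rfl fun k _ => ?_
    rw [kk_inner, PiLp.smul_apply, smul_eq_mul]
    ring
  simp_rw [e2]
  rw [integral_finsetSum _ fun k _ => (hint k).mul_const _, e1, Finset.mul_sum]
  refine Finset.sum_congr rfl fun k hk => ?_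
  rw [integral_mul_const, hval k hk]
  ring

lemma riesz_core {d : ℕ} {q : ℝ} (hq : 1 < q) {Θ : Type*} [MeasurableSpace Θ] (μ : Measure Θ)
    [IsFiniteMeasure μ] (h : Θ → (Fin d → ℝ) → ℝ) (F : (Fin d → ℝ) → ℝ) {A c D : ℝ} (hc : 0 ≤ c)
    (hA0 : 0 ≤ A) (hbd : ∀ θ x, |h θ x| ≤ A)
    (hmeas : Measurable fun p : (Fin d → ℝ) × Θ => h p.2 p.1)
    (hF : ∀ x, |F x| ≤ c * ∫ θ, |h θ x| ∂μ)
    (hle : ∀ᵐ θ ∂μ, (∫ x in box d, |h θ x| ^ q) ≤ D) :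
    II q F ≤ c ^ q * (μ.real Set.univ ^ q * (μ.real Set.univ)⁻¹) * (μ.real Set.univ * D) := by
  have hprod : Integrable (Function.uncurry fun (x : Fin d → ℝ) (θ : Θ) => |h θ x| ^ q)
      ((volume.restrict (box d)).prod μ) := by
    refine Integrable.of_bound (C := A ^ q) ?_ (Filter.Eventually.of_forall fun p => ?_)
    · exact ((hmeas.abs).pow_const q).aestronglyMeasurable
    · simp only [Function.uncurry]
      rw [Real.norm_of_nonneg (by positivity)]
      exact Real.rpow_le_rpow (abs_nonneg _) (hbd _ _) (by linarith)
  have hx : ∀ x, Measurable fun θ => h θ x := fun x => hmeas.comp (measurable_const.prodMk measurable_id)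
  have hxi : ∀ x, Integrable (fun θ => |h θ x| ^ q) μ := by
    intro x
    refine Integrable.of_bound (C := A ^ q) ((hx x).abs.pow_const q).aestronglyMeasurable
      (Filter.Eventually.of_forall fun p => ?_)
    rw [Real.norm_of_nonneg (by positivity)]
    exact Real.rpow_le_rpow (abs_nonneg _) (hbd _ _) (by linarith)
  have hxi1 : ∀ x, Integrable (fun θ => |h θ x|) μ := by
    intro x
    refine Integrable.of_bound (C := A) ((hx x).abs).aestronglyMeasurable
      (Filter.Eventually.of_forall fun p => ?_)
    rw [Real.norm_of_nonneg (by positivity)]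
    exact hbd _ _
  have hpt : ∀ x, |F x| ^ q ≤ c ^ q * (μ.real Set.univ ^ q * (μ.real Set.univ)⁻¹) * ∫ θ, |h θ x| ^ q ∂μ := by
    intro x
    have h2 := jensen_fin μ hq (fun θ => abs_nonneg (h θ x)) (hxi1 x) (hxi x)
    calc |F x| ^ q ≤ (c * ∫ θ, |h θ x| ∂μ) ^ q :=
          Real.rpow_le_rpow (abs_nonneg _) (hF x) (by linarith)
      _ = c ^ q * (∫ θ, |h θ x| ∂μ) ^ q :=
          Real.mul_rpow (by positivity) (integral_nonneg fun _ => abs_nonneg _)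
      _ ≤ c ^ q * ((μ.real Set.univ ^ q * (μ.real Set.univ)⁻¹) * ∫ θ, |h θ x| ^ q ∂μ) := by gcongr
      _ = _ := by ring
  have hswap := integral_integral_swap hprod
  have hfin : ∫ θ, (∫ x in box d, |h θ x| ^ q) ∂μ ≤ μ.real Set.univ * D := by
    have := integral_mono_of_nonneg (μ := μ) (f := fun θ => ∫ x in box d, |h θ x| ^ q)
      (g := fun _ => D)
      (Filter.Eventually.of_forall fun θ => integral_nonneg fun x => by positivity)
      (integrable_const _) hle
    rw [integral_const, smul_eq_mul] at this
    linarith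
  have hfirst : II q F ≤ c ^ q * (μ.real Set.univ ^ q * (μ.real Set.univ)⁻¹) *
      ∫ x in box d, ∫ θ, |h θ x| ^ q ∂μ := by
    rw [← integral_const_mul]
    exact integral_mono_of_nonneg (Filter.Eventually.of_forall fun _ => by positivity)
      (hprod.integral_prod_left.const_mul _) (Filter.Eventually.of_forall hpt)
  rw [hswap] at hfirst
  exact hfirst.trans (by gcongr)

lemma TR_sign_bd {d : ℕ} (S : Finset (Fin d → ℤ)) (a : (Fin d → ℤ) → ℂ)
    (θ : EuclideanSpace ℝ (Fin d)) (x : Fin d → ℝ) :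
    |TR S (fun k => -Complex.I * (Real.sign (∑ j, (k j : ℝ) * θ j) : ℝ) * a k) x| ≤ ∑ k ∈ S, ‖a k‖ := by
  rw [TR_real S a (fun k => Real.sign (∑ j, (k j : ℝ) * θ j)) x]
  refine (Finset.abs_sum_le_sum_abs _ _).trans (Finset.sum_le_sum fun k _ => ?_)
  rw [abs_mul]
  have h1 := abs_sign_le (∑ j, (k j : ℝ) * θ j)
  have h2 := Complex.abs_re_le_norm (-Complex.I * a k * ee k x)
  rw [norm_mul, norm_mul, ee_norm, norm_neg, Complex.norm_I, one_mul, mul_one] at h2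
  exact (mul_le_of_le_one_left (abs_nonneg _) h1).trans h2

lemma TR_sign_meas {d : ℕ} (S : Finset (Fin d → ℤ)) (a : (Fin d → ℤ) → ℂ) :
    Measurable fun p : (Fin d → ℝ) × EuclideanSpace ℝ (Fin d) =>
      TR S (fun k => -Complex.I * (Real.sign (∑ j, (k j : ℝ) * p.2 j) : ℝ) * a k) p.1 := by
  have : (fun p : (Fin d → ℝ) × EuclideanSpace ℝ (Fin d) =>
      TR S (fun k => -Complex.I * (Real.sign (∑ j, (k j : ℝ) * p.2 j) : ℝ) * a k) p.1)
      = fun p => ∑ k ∈ S, Real.sign (∑ j, (k j : ℝ) * p.2 j) * (-Complex.I * a k * ee k p.1).re := by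
    funext p
    exact TR_real S a (fun k => Real.sign (∑ j, (k j : ℝ) * p.2 j)) p.1
  rw [this]
  refine Finset.measurable_fun_sum _ fun k _ => Measurable.mul ?_ ?_
  · exact measurable_sign_real.comp (by fun_prop)
  · have := ee_continuous k
    exact (Continuous.measurable (by fun_prop))

lemma riesz_pt {d : ℕ} {c : ℝ} (hc : 0 < c) (j : Fin d) (g : EuclideanSpace ℝ (Fin d) → ℝ) {A y : ℝ}
    (hg : Measurable g) (hA : ∀ θ, |g θ| ≤ A)
    (h : c * y = ∫ θ in Metric.ball (0 : EuclideanSpace ℝ (Fin d)) 1, θ j * g θ) :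
    |y| ≤ c⁻¹ * ∫ θ in Metric.ball (0 : EuclideanSpace ℝ (Fin d)) 1, |g θ| := by
  have : IsFiniteMeasure ((volume : Measure (EuclideanSpace ℝ (Fin d))).restrict (Metric.ball 0 1)) :=
    isFiniteMeasure_restrict.2 measure_ball_lt_top.ne
  have e : y = c⁻¹ * ∫ θ in Metric.ball (0 : EuclideanSpace ℝ (Fin d)) 1, θ j * g θ := by
    rw [← h]; field_simp
  rw [e, abs_mul, abs_of_pos (inv_pos.2 hc)]
  gcongr
  refine (abs_integral_le_integral_abs).trans ?_
  refine integral_mono_of_nonneg (Filter.Eventually.of_forall fun _ => abs_nonneg _) ?_ ?_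
  · refine Integrable.of_bound (C := A) (hg.abs).aestronglyMeasurable
      (Filter.Eventually.of_forall fun p => ?_)
    rw [Real.norm_of_nonneg (abs_nonneg _)]
    exact hA _
  filter_upwards [ae_restrict_mem measurableSet_ball] with θ hθ
  rw [abs_mul]
  have h1 : ‖θ‖ < 1 := by simpa using hθ
  have h2 := PiLp.norm_apply_le θ j
  rw [Real.norm_eq_abs] at h2
  exact mul_le_of_le_one_left (abs_nonneg _) (by linarith)



lemma TR_sign_meas1 {d : ℕ} (S : Finset (Fin d → ℤ)) (a : (Fin d → ℤ) → ℂ) (x : Fin d → ℝ) :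
    Measurable fun θ : EuclideanSpace ℝ (Fin d) =>
      TR S (fun k => -Complex.I * (Real.sign (∑ j, (k j : ℝ) * θ j) : ℝ) * a k) x := by
  have : (fun θ : EuclideanSpace ℝ (Fin d) =>
      TR S (fun k => -Complex.I * (Real.sign (∑ j, (k j : ℝ) * θ j) : ℝ) * a k) x)
      = fun θ => ∑ k ∈ S, Real.sign (∑ j, (k j : ℝ) * θ j) * (-Complex.I * a k * ee k x).re := by
    funext θ
    exact TR_real S a (fun k => Real.sign (∑ j, (k j : ℝ) * θ j)) x
  rw [this]
  refine Finset.measurable_fun_sum _ fun k _ => Measurable.mul ?_ measurable_const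
  exact measurable_sign_real.comp (by fun_prop)

theorem riesz (d : ℕ) {q : ℝ} (hq : 1 < q) : ∃ C : ℝ, 0 < C ∧
    ∀ (S : Finset (Fin d → ℤ)) (a : (Fin d → ℤ) → ℂ) (j : Fin d), 0 ∉ S →
    II q (TR S (RR j a)) ≤ C * II q (TR S a) := by
  obtain ⟨c, hc, hrep⟩ := riesz_rep (d := d)
  obtain ⟨C, hC, hH⟩ := hilb hq
  have hfm : IsFiniteMeasure ((volume : Measure (EuclideanSpace ℝ (Fin d))).restrict (Metric.ball 0 1)) :=
    isFiniteMeasure_restrict.2 measure_ball_lt_top.ne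
  obtain ⟨m, hm⟩ : ∃ m, m = ((volume : Measure (EuclideanSpace ℝ (Fin d))).restrict
    (Metric.ball 0 1)).real Set.univ := ⟨_, rfl⟩
  have hm0 : 0 ≤ m := hm ▸ measureReal_nonneg
  refine ⟨c⁻¹ ^ q * (m ^ q * m⁻¹) * (m * C) + 1, by positivity, fun S a j hS => ?_⟩
  have hII0 : 0 ≤ II q (TR S a) := integral_nonneg fun _ => by positivity
  have hle : ∀ᵐ θ ∂((volume : Measure (EuclideanSpace ℝ (Fin d))).restrict (Metric.ball 0 1)),
      (∫ x in box d, |TR S (fun k => -Complex.I * (Real.sign (∑ j, (k j : ℝ) * θ j) : ℝ) * a k) x| ^ q)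
      ≤ C * II q (TR S a) := by
    have : ∀ᵐ θ : EuclideanSpace ℝ (Fin d), ∀ k ∈ S, ∑ j, (k j : ℝ) * θ j ≠ 0 := by
      rw [Filter.eventually_all_finset]
      intro k hk
      exact hyper_null (by rintro rfl; exact hS hk)
    filter_upwards [ae_restrict_of_ae this] with θ hθ
    exact hH S a (fun j => θ j) hθ
  have hF : ∀ x, |TR S (RR j a) x| ≤ c⁻¹ * ∫ θ in Metric.ball (0 : EuclideanSpace ℝ (Fin d)) 1,
      |TR S (fun k => -Complex.I * (Real.sign (∑ j, (k j : ℝ) * θ j) : ℝ) * a k) x| := by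
    intro x
    refine riesz_pt hc j (fun θ : EuclideanSpace ℝ (Fin d) =>
      TR S (fun k => -Complex.I * (Real.sign (∑ j, (k j : ℝ) * θ j) : ℝ) * a k) x)
      (A := ∑ k ∈ S, ‖a k‖) ?_ ?_ ?_
    · exact TR_sign_meas1 S a x
    · exact fun θ => TR_sign_bd S a θ x
    · exact hrep S a j hS x
  have hA : 0 ≤ ∑ k ∈ S, ‖a k‖ := Finset.sum_nonneg fun k _ => norm_nonneg (a k)
  have hc' : 0 ≤ c⁻¹ := inv_nonneg.2 hc.le
  have hbd := TR_sign_bd S a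
  have hms := TR_sign_meas S a
  have h := riesz_core hq ((volume : Measure (EuclideanSpace ℝ (Fin d))).restrict (Metric.ball 0 1))
    (fun (θ : EuclideanSpace ℝ (Fin d)) x =>
    TR S (fun k => -Complex.I * (Real.sign (∑ j, (k j : ℝ) * θ j) : ℝ) * a k) x) (TR S (RR j a))
    hc' hA hbd hms hF hle
  rw [← hm] at h
  refine h.trans ?_
  rw [add_mul, one_mul, ← mul_assoc m, ← mul_assoc]
  exact le_add_of_nonneg_right hII0


/-! ## Part E: Korn inequality for trigonometric polynomials -/

lemma II_sum {d : ℕ} {q : ℝ} (hq : 1 < q) {ι : Type*} [Fintype ι] (f : ι → (Fin d → ℝ) → ℝ)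
    (hf : ∀ i, Continuous (f i)) {D : ℝ} (hD : ∀ i, II q (f i) ≤ D) :
    II q (fun x => ∑ i, f i x) ≤ (Fintype.card ι : ℝ) ^ (q - 1) * (Fintype.card ι * D) := by
  have hc : ∀ i, Continuous fun x => |f i x| ^ q := fun i =>
    (hf i).abs.rpow_const fun x => Or.inr (by linarith)
  have h1 : ∀ x, |∑ i, f i x| ^ q ≤ (Fintype.card ι : ℝ) ^ (q - 1) * ∑ i, |f i x| ^ q := fun x =>
    (Real.rpow_le_rpow (abs_nonneg _) (Finset.abs_sum_le_sum_abs _ _) (by linarith)).trans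
      (Real.rpow_sum_le_const_mul_sum_rpow Finset.univ _ hq.le)
  have h2 : II q (fun x => ∑ i, f i x) ≤ ∫ x in box d, (Fintype.card ι : ℝ) ^ (q - 1) * ∑ i, |f i x| ^ q :=
    integral_mono_of_nonneg (Filter.Eventually.of_forall fun _ => by positivity)
      ((continuous_finsetSum _ fun i _ => hc i).integrable_box.const_mul _)
      (Filter.Eventually.of_forall h1)
  rw [integral_const_mul, integral_finsetSum _ fun i _ => (hc i).integrable_box] at h2
  refine h2.trans ?_
  gcongr
  calc ∑ i, ∫ x in box d, |f i x| ^ q ≤ ∑ _i : ι, D := Finset.sum_le_sum fun i _ => hD i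
    _ = _ := by simp

lemma RR_RR {d : ℕ} (l i : Fin d) (b : (Fin d → ℤ) → ℂ) (k : Fin d → ℤ) :
    RR l (RR i b) k = -((k l : ℂ) * (k i : ℂ) / ((‖kk k‖ ^ 2 : ℝ) : ℂ)) * b k := by
  unfold RR
  push_cast
  have : Complex.I * Complex.I = -1 := Complex.I_mul_I
  linear_combination ((k l : ℂ) / ‖kk k‖ * ((k i : ℂ) / ‖kk k‖) * b k) * this

lemma kk_norm_sq {d : ℕ} (k : Fin d → ℤ) : ((‖kk k‖ ^ 2 : ℝ) : ℂ) = ∑ l, (k l : ℂ) ^ 2 := by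
  rw [EuclideanSpace.norm_sq_eq]
  push_cast
  refine Finset.sum_congr rfl fun l _ => ?_
  simp only [kk, Real.norm_eq_abs]
  rw [← Complex.ofReal_pow, sq_abs]
  push_cast; rfl

def AA {d : ℕ} (a : Fin d → (Fin d → ℤ) → ℂ) (i j : Fin d) (k : Fin d → ℤ) : ℂ :=
  Complex.I * (k j : ℂ) * a i k

def EE {d : ℕ} (a : Fin d → (Fin d → ℤ) → ℂ) (i j : Fin d) (k : Fin d → ℤ) : ℂ :=
  (AA a i j k + AA a j i k) / 2

lemma AA_eq {d : ℕ} (a : Fin d → (Fin d → ℤ) → ℂ) (i j : Fin d) {k : Fin d → ℤ} (hk : k ≠ 0) :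
    AA a i j k = EE a i j k +
      (∑ l, RR l (RR i (EE a j l)) k + ∑ l, -RR l (RR j (EE a i l)) k) := by
  simp_rw [RR_RR]
  set N := ((‖kk k‖ ^ 2 : ℝ) : ℂ) with hN
  have hN0 : N ≠ 0 := by
    rw [hN]
    have := norm_pos_iff.2 (kk_ne hk)
    exact_mod_cast (by positivity : (‖kk k‖ ^ 2 : ℝ) ≠ 0)
  rw [← Finset.sum_add_distrib]
  have : ∀ l, -((k l : ℂ) * (k i : ℂ) / N) * EE a j l k + -(-((k l : ℂ) * (k j : ℂ) / N) * EE a i l k)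
      = (k l : ℂ) ^ 2 * (Complex.I * ((k j : ℂ) * a i k - (k i : ℂ) * a j k) / (2 * N)) := by
    intro l
    unfold EE AA
    field_simp
    ring
  simp_rw [this]
  rw [← Finset.sum_mul, ← kk_norm_sq, ← hN]
  unfold EE AA
  field_simp
  ring

lemma TR_erase {d : ℕ} (S : Finset (Fin d → ℤ)) (b : (Fin d → ℤ) → ℂ) (h : b 0 = 0) :
    TR S b = TR (S.erase 0) b := by
  funext x
  unfold TR
  rw [Finset.sum_erase]
  simp [h]

theorem korn_trig (d : ℕ) {q : ℝ} (hq : 1 < q) : ∃ C : ℝ, 0 < C ∧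
    ∀ (S : Finset (Fin d → ℤ)) (a : Fin d → (Fin d → ℤ) → ℂ) (i j : Fin d),
    II q (TR S (AA a i j)) ≤ C * ∑ i', ∑ j', II q (TR S (EE a i' j')) := by
  obtain ⟨C, hC, hR⟩ := riesz d hq
  set ι := Option (Fin d ⊕ Fin d)
  refine ⟨(Fintype.card ι : ℝ) ^ (q - 1) * (Fintype.card ι * (1 + C * C)), by positivity, ?_⟩
  have main : ∀ (S : Finset (Fin d → ℤ)) (a : Fin d → (Fin d → ℤ) → ℂ) (i j : Fin d), 0 ∉ S →
      II q (TR S (AA a i j)) ≤ (Fintype.card ι : ℝ) ^ (q - 1) * (Fintype.card ι * (1 + C * C)) *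
        ∑ i', ∑ j', II q (TR S (EE a i' j')) := by
    intro S a i j hS
    set T := ∑ i', ∑ j', II q (TR S (EE a i' j')) with hT
    have hII0 : ∀ f : (Fin d → ℝ) → ℝ, 0 ≤ II q f := fun f => integral_nonneg fun _ => by positivity
    have hle : ∀ i' j', II q (TR S (EE a i' j')) ≤ T := by
      intro i' j'
      refine (Finset.single_le_sum (f := fun j' => II q (TR S (EE a i' j'))) (fun _ _ => hII0 _)
        (Finset.mem_univ j')).trans ?_
      exact Finset.single_le_sum (f := fun i' => ∑ j', II q (TR S (EE a i' j')))
        (fun _ _ => Finset.sum_nonneg fun _ _ => hII0 _) (Finset.mem_univ i')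
    have hT0 : 0 ≤ T := (hII0 _).trans (hle i j)
    have hRR : ∀ l i' j' l', II q (TR S (RR l (RR i' (EE a j' l')))) ≤ C * C * T := by
      intro l i' j' l'
      refine (hR S _ l hS).trans ?_
      rw [mul_assoc]
      gcongr
      refine (hR S _ i' hS).trans ?_
      gcongr
      exact hle _ _
    let f : ι → (Fin d → ℝ) → ℝ := fun o => match o with
      | none => TR S (EE a i j)
      | some (Sum.inl l) => TR S (RR l (RR i (EE a j l)))
      | some (Sum.inr l) => fun x => -TR S (RR l (RR j (EE a i l))) x
    have hf : ∀ o, Continuous (f o) := by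
      rintro (_ | l | l)
      · exact TR_cont _ _
      · exact TR_cont _ _
      · exact (TR_cont _ _).neg
    have hD : ∀ o, II q (f o) ≤ (1 + C * C) * T := by
      rintro (_ | l | l)
      · have := hle i j
        change II q (TR S (EE a i j)) ≤ _
        nlinarith [mul_nonneg (mul_nonneg hC.le hC.le) hT0]
      · have := hRR l i j l
        change II q (TR S (RR l (RR i (EE a j l)))) ≤ _
        nlinarith
      · have := hRR l j i l
        have e : II q (f (some (Sum.inr l))) = II q (TR S (RR l (RR j (EE a i l)))) := by
          unfold II
          simp only [f, abs_neg]
        rw [e]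
        nlinarith
    have h := II_sum hq f hf hD
    have e : (fun x => ∑ o, f o x) = TR S (AA a i j) := by
      funext x
      rw [Fintype.sum_option, Fintype.sum_sum_type]
      simp only [f]
      unfold TR
      simp only [← Complex.neg_re, ← Complex.re_sum, ← Complex.add_re]
      congr 1
      rw [Finset.sum_congr rfl fun l _ => (Finset.sum_neg_distrib _).symm]
      rw [Finset.sum_comm, Finset.sum_comm (s := Finset.univ), ← Finset.sum_add_distrib,
        ← Finset.sum_add_distrib]
      refine Finset.sum_congr rfl fun k hk => ?_
      rw [AA_eq a i j (k := k) (by rintro rfl; exact hS hk), add_mul, add_mul, Finset.sum_mul,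
        Finset.sum_mul]
      simp
    rw [e] at h
    refine h.trans (le_of_eq ?_)
    ring
  intro S a i j
  have hA : ∀ i j, AA a i j 0 = 0 := fun i j => by simp [AA]
  have hE : ∀ i j, EE a i j 0 = 0 := fun i j => by simp [EE, hA]
  rw [TR_erase S _ (hA i j)]
  simp_rw [TR_erase S _ (hE _ _)]
  exact main _ a i j (by simp)


/-! ## Part F: approximation by trigonometric polynomials -/

def LL {d : ℕ} (z : Fin d → ℝ) : ℝ := ∏ i, (1 - Real.cos (z i)) / 2

lemma LL_cont {d : ℕ} : Continuous (LL (d := d)) := by unfold LL; fun_prop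

lemma fac_nonneg (t : ℝ) : 0 ≤ (1 - Real.cos t) / 2 := by linarith [Real.cos_le_one t]
lemma fac_le (t : ℝ) : (1 - Real.cos t) / 2 ≤ 1 := by linarith [Real.neg_one_le_cos t]

lemma LL_nonneg {d : ℕ} (z : Fin d → ℝ) : 0 ≤ LL z := Finset.prod_nonneg fun i _ => fac_nonneg (z i)

lemma LL_pi {d : ℕ} : LL (fun _ : Fin d => π) = 1 := by
  unfold LL; simp

lemma LL_per {d : ℕ} : IsPer (LL (d := d)) := by
  intro x i
  unfold LL
  refine Finset.prod_congr rfl fun j _ => ?_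
  by_cases h : j = i
  · subst h; simp
  · simp [h]

lemma LL_lt {d : ℕ} {z : Fin d → ℝ} (hz : z ∈ Set.Icc (fun _ => (0 : ℝ)) (fun _ : Fin d => 2 * π))
    (hne : z ≠ fun _ => π) : LL z < 1 := by
  obtain ⟨i, hi⟩ := Function.ne_iff.1 hne
  have h0 := hz.1 i
  have h1 := hz.2 i
  simp only at h0 h1
  have hpi := Real.pi_pos
  have hc : Real.cos (z i) ≠ -1 := by
    intro h
    obtain ⟨k, hk⟩ := Real.cos_eq_neg_one_iff.1 h
    have h3 : (k : ℝ) < 1 := by nlinarith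
    have h4 : (-1 : ℝ) < k := by nlinarith
    have h5 : k < 1 := by exact_mod_cast h3
    have h6 : -1 < k := by exact_mod_cast h4
    have : k = 0 := by omega
    subst this
    apply hi
    simpa using hk.symm
  have hlt : (1 - Real.cos (z i)) / 2 < 1 := by
    have := lt_of_le_of_ne (Real.neg_one_le_cos (z i)) (Ne.symm hc)
    linarith
  unfold LL
  rw [← Finset.mul_prod_erase _ _ (Finset.mem_univ i)]
  have hP : ∏ j ∈ Finset.univ.erase i, (1 - Real.cos (z j)) / 2 ≤ 1 :=
    Finset.prod_le_one (fun j _ => fac_nonneg _) fun j _ => fac_le _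
  have := fac_nonneg (z i)
  nlinarith

/-- characters as a monoid hom into functions -/
def eeHom (d : ℕ) : Multiplicative (Fin d → ℤ) →* ((Fin d → ℝ) → ℂ) where
  toFun k := ee (Multiplicative.toAdd k)
  map_one' := by funext x; simp [ee]
  map_mul' k l := by funext x; exact ee_add_left _ _ x

def trigAlg (d : ℕ) : Subalgebra ℂ ((Fin d → ℝ) → ℂ) :=
  (AddMonoidAlgebra.lift ℂ ((Fin d → ℝ) → ℂ) (Fin d → ℤ) (eeHom d)).range

lemma ee_mem {d : ℕ} (k : Fin d → ℤ) : ee k ∈ trigAlg d :=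
  ⟨AddMonoidAlgebra.single k 1, by simp [eeHom]⟩

lemma trig_expand {d : ℕ} {f : (Fin d → ℝ) → ℂ} (hf : f ∈ trigAlg d) :
    ∃ (S : Finset (Fin d → ℤ)) (b : (Fin d → ℤ) → ℂ), ∀ x, f x = ∑ k ∈ S, b k * ee k x := by
  obtain ⟨p, rfl⟩ := hf
  refine ⟨p.coeff.support, p.coeff, fun x => ?_⟩
  simp [AddMonoidAlgebra.lift_apply, Finsupp.sum, eeHom]

lemma LL_trig {d : ℕ} (n : ℕ) : (fun z : Fin d → ℝ => ((LL z ^ n : ℝ) : ℂ)) ∈ trigAlg d := by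
  have h : ∀ i : Fin d, (fun z : Fin d → ℝ => (((1 - Real.cos (z i)) / 2 : ℝ) : ℂ)) ∈ trigAlg d := by
    intro i
    have : (fun z : Fin d → ℝ => (((1 - Real.cos (z i)) / 2 : ℝ) : ℂ))
        = (1 / 2 : ℂ) • (1 : (Fin d → ℝ) → ℂ) - (1 / 4 : ℂ) • (ee (Pi.single i 1) + ee (-Pi.single i 1)) := by
      funext z
      have h1 : ee (Pi.single i 1) z = Complex.exp (z i * Complex.I) := by
        simp [ee, Pi.single_apply, mul_comm]
      have h2 : ee (-Pi.single i 1) z = Complex.exp (-z i * Complex.I) := by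
        simp [ee, Pi.single_apply, mul_comm]
      simp only [Pi.sub_apply, Pi.smul_apply, Pi.add_apply, Pi.one_apply, smul_eq_mul, h1, h2]
      push_cast
      rw [Complex.cos]
      ring
    rw [this]
    exact sub_mem (Subalgebra.smul_mem _ (one_mem _) _) (Subalgebra.smul_mem _ (add_mem (ee_mem _) (ee_mem _)) _)
  have e : (fun z : Fin d → ℝ => ((LL z ^ n : ℝ) : ℂ))
      = (∏ i, fun z : Fin d → ℝ => (((1 - Real.cos (z i)) / 2 : ℝ) : ℂ)) ^ n := by
    funext z
    simp [LL, Finset.prod_apply]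
  rw [e]
  exact pow_mem (prod_mem fun i _ => h i) n

def ZZ (d n : ℕ) : ℝ := ∫ z in box d, LL z ^ n

def ppi (d : ℕ) : Fin d → ℝ := fun _ => π

def PP {d : ℕ} (n : ℕ) (g : (Fin d → ℝ) → ℝ) (x : Fin d → ℝ) : ℝ :=
  (ZZ d n)⁻¹ * ∫ y in box d, g y * LL (x - ppi d - y) ^ n

/-- Fourier coefficient -/
def FC {d : ℕ} (g : (Fin d → ℝ) → ℝ) (k : Fin d → ℤ) : ℂ := ∫ y in box d, (g y : ℂ) * ee k (-y)

lemma FC_int {d : ℕ} {g : (Fin d → ℝ) → ℝ} (hg : Continuous g) (k : Fin d → ℤ) :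
    Integrable (fun y => (g y : ℂ) * ee k (-y)) (volume.restrict (box d)) := by
  have := ee_continuous k
  exact Continuous.integrable_box (by fun_prop)

lemma PP_trig (d n : ℕ) : ∃ (S : Finset (Fin d → ℤ)) (β : (Fin d → ℤ) → ℂ),
    ∀ g : (Fin d → ℝ) → ℝ, Continuous g → PP n g = TR S (fun k => β k * FC g k) := by
  obtain ⟨S, b, hb⟩ := trig_expand (LL_trig (d := d) n)
  refine ⟨S, fun k => ((ZZ d n)⁻¹ : ℝ) * (b k * ee k (-ppi d)), fun g hg => ?_⟩
  funext x
  unfold PP TR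
  rw [← Complex.ofReal_re ((ZZ d n)⁻¹ * ∫ y in box d, g y * LL (x - ppi d - y) ^ n)]
  congr 1
  rw [Complex.ofReal_mul, ← integral_complex_ofReal]
  have e : ∀ y, ((g y * LL (x - ppi d - y) ^ n : ℝ) : ℂ)
      = ∑ k ∈ S, (b k * ee k (-ppi d) * ee k x) * ((g y : ℂ) * ee k (-y)) := by
    intro y
    have := hb (x - ppi d - y)
    rw [Complex.ofReal_mul, this, Finset.mul_sum]
    refine Finset.sum_congr rfl fun k _ => ?_
    rw [sub_eq_add_neg, sub_eq_add_neg, ee_add, ee_add]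
    ring
  simp_rw [e]
  rw [integral_finsetSum _ fun k _ => (FC_int hg k).const_mul _, Finset.mul_sum]
  refine Finset.sum_congr rfl fun k _ => ?_
  rw [integral_const_mul]
  unfold FC
  ring

lemma ZZ_shift {d : ℕ} (n : ℕ) (c : Fin d → ℝ) : ∫ y in box d, LL (c - y) ^ n = ZZ d n :=
  integral_box_sub (f := fun z => LL z ^ n) (LL_cont.pow n)
    (fun x i => by simp only [LL_per x i]) c

lemma PP_bound {d : ℕ} (n : ℕ) {g : (Fin d → ℝ) → ℝ} {M : ℝ} (hM0 : 0 ≤ M)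
    (hM : ∀ y ∈ Set.Icc (fun _ => (0 : ℝ)) (fun _ : Fin d => 2 * π), |g y| ≤ M) (x : Fin d → ℝ) :
    |PP n g x| ≤ M := by
  have hZ : 0 ≤ ZZ d n := integral_nonneg fun z => pow_nonneg (LL_nonneg z) n
  have hc : Continuous fun y : Fin d → ℝ => LL (x - ppi d - y) ^ n :=
    (LL_cont.comp (by fun_prop)).pow n
  have h : |∫ y in box d, g y * LL (x - ppi d - y) ^ n| ≤ M * ZZ d n := by
    rw [← ZZ_shift n (x - ppi d), ← integral_const_mul]
    refine abs_integral_le_integral_abs.trans ?_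
    refine integral_mono_of_nonneg (Filter.Eventually.of_forall fun _ => abs_nonneg _)
      (hc.integrable_box.const_mul _) ?_
    rw [restrict_box]
    filter_upwards [ae_restrict_mem measurableSet_Icc] with y hy
    rw [abs_mul, abs_of_nonneg (pow_nonneg (LL_nonneg _) n)]
    exact mul_le_mul_of_nonneg_right (hM y hy) (pow_nonneg (LL_nonneg _) n)
  unfold PP
  rw [abs_mul, abs_of_nonneg (inv_nonneg.2 hZ)]
  rcases hZ.eq_or_lt with h0 | h0
  · rw [← h0]; simpa using hM0
  · calc (ZZ d n)⁻¹ * _ ≤ (ZZ d n)⁻¹ * (M * ZZ d n) := by gcongr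
      _ = M := by field_simp

lemma PP_tendsto {d : ℕ} {g : (Fin d → ℝ) → ℝ} (hg : Continuous g) (hp : IsPer g) (x : Fin d → ℝ) :
    Filter.Tendsto (fun n => PP n g x) Filter.atTop (nhds (g x)) := by
  have hcg : Continuous fun w => g (x - ppi d - w) := by fun_prop
  have hint : (ppi d) ∈ interior (Set.Icc (fun _ => (0 : ℝ)) (fun _ : Fin d => 2 * π)) := by
    have ho : IsOpen (box d) := isOpen_set_pi Set.finite_univ fun _ _ => isOpen_Ioo
    refine interior_maximal (t := box d) ?_ ho ?_
    · intro y hy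
      exact ⟨fun i => (hy i trivial).1.le, fun i => (hy i trivial).2.le⟩
    · intro i _
      exact ⟨Real.pi_pos, by simp only [ppi]; linarith [Real.pi_pos]⟩
  have key := tendsto_setIntegral_pow_smul_of_unique_maximum_of_isCompact_of_continuousOn
    (μ := (volume : Measure (Fin d → ℝ))) (c := LL) (g := fun w => g (x - ppi d - w)) (x₀ := ppi d)
    (isCompact_Icc (a := fun _ : Fin d => (0 : ℝ)) (b := fun _ => 2 * π)) LL_cont.continuousOn
    (fun y hy hne => by
      have : LL (ppi d) = 1 := LL_pi
      rw [this]; exact LL_lt hy hne)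
    (fun y _ => LL_nonneg y) (by
      have : LL (ppi d) = 1 := LL_pi
      rw [this]; exact one_pos) (subset_closure hint) hcg.continuousOn
  have e1 : g (x - ppi d - ppi d) = g x := by
    have := hp.add_int (fun _ => 1) (x - ppi d - ppi d)
    rw [← this]
    congr 1
    funext i
    simp [ppi]
    ring
  rw [e1] at key
  refine key.congr fun n => ?_
  rw [← restrict_box]
  unfold PP ZZ
  rw [smul_eq_mul]
  congr 1
  have h := integral_box_sub (f := fun w => LL w ^ n • g (x - ppi d - w))
    ((LL_cont.pow n).smul hcg) (fun y i => by
      simp only [LL_per y i]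
      congr 1
      have := hp (x - ppi d - (y + Pi.single i (2 * π))) i
      rw [← this]
      congr 1
      abel) (x - ppi d)
  rw [← h]
  congr 1
  funext y
  simp only [smul_eq_mul, sub_sub_cancel]
  ring

lemma II_tendsto {d : ℕ} {q : ℝ} (hq : 1 < q) {g : (Fin d → ℝ) → ℝ} (hg : Continuous g) (hp : IsPer g) :
    Filter.Tendsto (fun n => II q (PP n g)) Filter.atTop (nhds (II q g)) := by
  obtain ⟨M, hM⟩ := (isCompact_Icc (a := fun _ : Fin d => (0 : ℝ)) (b := fun _ => 2 * π)).exists_bound_of_continuousOn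
    hg.continuousOn
  have hM' : ∀ y ∈ Set.Icc (fun _ => (0 : ℝ)) (fun _ : Fin d => 2 * π), |g y| ≤ max M 0 :=
    fun y hy => (hM y hy).trans (le_max_left _ _)
  unfold II
  refine tendsto_integral_of_dominated_convergence (fun _ => (max M 0) ^ q) ?_ (integrable_const _) ?_ ?_
  · intro n
    obtain ⟨S, β, h⟩ := PP_trig d n
    rw [h g hg]
    exact (((TR_cont _ _).abs).rpow_const fun _ => Or.inr (by linarith)).aestronglyMeasurable
  · intro n
    refine Filter.Eventually.of_forall fun x => ?_
    rw [Real.norm_of_nonneg (by positivity)]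
    exact Real.rpow_le_rpow (abs_nonneg _) (PP_bound n (le_max_right _ _) hM' x) (by linarith)
  · refine Filter.Eventually.of_forall fun x => ?_
    exact ((PP_tendsto hg hp x).abs).rpow_const (Or.inr (by linarith))

/-! ## Part G: conclusion -/

lemma ee_line {d : ℕ} (k : Fin d → ℤ) (j : Fin d) (x : Fin d → ℝ) :
    HasDerivAt (fun t : ℝ => ee k (-(x + t • Pi.single j (1 : ℝ))))
      (-(Complex.I * (k j : ℂ)) * ee k (-x)) 0 := by
  have e : (fun t : ℝ => ee k (-(x + t • Pi.single j (1 : ℝ))))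
      = fun t : ℝ => ee k (-x) * Complex.exp ((t : ℂ) * -(Complex.I * (k j : ℂ))) := by
    funext t
    rw [neg_add, ee_add]
    congr 1
    unfold ee
    congr 1
    simp [Pi.single_apply]
    ring
  rw [e]
  have h1 : HasDerivAt (fun t : ℝ => (t : ℂ) * -(Complex.I * (k j : ℂ))) (1 * -(Complex.I * (k j : ℂ))) 0 :=
    (HasDerivAt.ofReal_comp (hasDerivAt_id (0 : ℝ))).mul_const _
  have h2 := (h1.cexp).const_mul (ee k (-x))
  convert! h2 using 1
  simp
  ring

lemma FC_deriv {d : ℕ} {g : (Fin d → ℝ) → ℝ} (hg : ContDiff ℝ (⊤ : ℕ∞) g) (hp : IsPer g)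
    (k : Fin d → ℤ) (j : Fin d) : FC (pd g j) k = Complex.I * (k j : ℂ) * FC g k := by
  have hgc : Continuous g := hg.continuous
  have hpc : Continuous (pd g j) := (hg.continuous_fderiv (by simp)).clm_apply continuous_const
  have hek := ee_continuous k
  have h := integral_box_deriv (d := d) (f := fun y => (g y : ℂ) * ee k (-y)) (v := Pi.single j 1)
    (f' := fun y => (pd g j y : ℂ) * ee k (-y) + (g y : ℂ) * (-(Complex.I * (k j : ℂ)) * ee k (-y)))
    (by fun_prop) (fun x i => by
      simp only [hp x i]
      congr 1
      have := ee_isPer k (-(x + Pi.single i (2 * π))) i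
      rw [← this]
      congr 1
      abel) (by fun_prop) (fun x => by
      have hd : HasDerivAt (fun t : ℝ => g (x + t • Pi.single j (1 : ℝ))) (pd g j x) 0 := by
        have hf : HasFDerivAt g (fderiv ℝ g x) (x + (0 : ℝ) • Pi.single j (1 : ℝ)) := by
          simpa using ((hg.differentiable (by simp)) x).hasFDerivAt
        have hl : HasDerivAt (fun t : ℝ => x + t • (Pi.single j (1 : ℝ) : Fin d → ℝ)) (Pi.single j 1) 0 := by
          simpa using ((hasDerivAt_id (0 : ℝ)).smul_const (Pi.single j (1 : ℝ) : Fin d → ℝ)).const_add x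
        exact hf.comp_hasDerivAt (0 : ℝ) hl
      have := (HasDerivAt.ofReal_comp hd).mul (ee_line k j x)
      simp only [zero_smul, add_zero] at this
      exact this)
  have e : ∀ y, (g y : ℂ) * (-(Complex.I * (k j : ℂ)) * ee k (-y))
      = -(Complex.I * (k j : ℂ)) * ((g y : ℂ) * ee k (-y)) := fun y => by ring
  simp_rw [e] at h
  rw [integral_add (FC_int hpc k) ((FC_int hgc k).const_mul _), integral_const_mul] at h
  unfold FC
  linear_combination h

theorem korn_entry (d : ℕ) {q : ℝ} (hq : 1 < q) : ∃ C : ℝ, 0 < C ∧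
    ∀ u : (Fin d → ℝ) → (Fin d → ℝ), ContDiff ℝ (⊤ : ℕ∞) u → IsPer u → ∀ i j,
    II q (fun x => gradM u x i j) ≤ C * ∑ i', ∑ j', II q (fun x => symG u x i' j') := by
  obtain ⟨C, hC, h⟩ := korn_trig d hq
  refine ⟨C, hC, fun u hu hp i j => ?_⟩
  have hui : ∀ i, ContDiff ℝ (⊤ : ℕ∞) fun y => u y i := fun i => (contDiff_pi.1 hu) i
  have hpi : ∀ i, IsPer fun y => u y i := fun i x l => by simp only [hp x l]
  have hgc : ∀ i j, Continuous fun x => gradM u x i j := fun i j =>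
    ((hui i).continuous_fderiv (by simp)).clm_apply continuous_const
  have hgp : ∀ i j, IsPer fun x => gradM u x i j := by
    intro i j x l
    simp only [gradM, pd]
    congr 1
    have : (fun y => u y i) = fun y => u (y + Pi.single l (2 * π)) i := by
      funext y; rw [hp y l]
    conv_rhs => rw [this]
    rw [fderiv_comp_add_right (f := fun y => u y i)]
  have hsc : ∀ i j, Continuous fun x => symG u x i j := fun i j =>
    ((hgc i j).add (hgc j i)).div_const 2
  have hsp : ∀ i j, IsPer fun x => symG u x i j := by
    intro i j x l
    have h1 := hgp i j x l
    have h2 := hgp j i x l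
    simp only [symG]
    simp only at h1 h2
    rw [h1, h2]
  refine le_of_tendsto_of_tendsto' (II_tendsto hq (hgc i j) (hgp i j))
    ((tendsto_finsetSum Finset.univ fun i' _ => tendsto_finsetSum Finset.univ fun j' _ =>
      II_tendsto hq (hsc i' j') (hsp i' j')).const_mul C) fun n => ?_
  obtain ⟨S, β, hβ⟩ := PP_trig d n
  have key := h S (fun i k => β k * FC (fun y => u y i) k) i j
  have hA : ∀ i j, (fun k => β k * FC (fun x => gradM u x i j) k)
      = AA (fun i k => β k * FC (fun y => u y i) k) i j := by
    intro i j
    funext k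
    have := FC_deriv (hui i) (hpi i) k j
    change β k * FC (pd (fun y => u y i) j) k = _
    rw [this]
    unfold AA
    ring
  have hE : ∀ i j, (fun k => β k * FC (fun x => symG u x i j) k)
      = EE (fun i k => β k * FC (fun y => u y i) k) i j := by
    intro i j
    funext k
    unfold EE
    rw [← hA, ← hA]
    have : FC (fun x => symG u x i j) k
        = (FC (fun x => gradM u x i j) k + FC (fun x => gradM u x j i) k) / 2 := by
      unfold FC
      rw [← integral_add (FC_int (hgc i j) k) (FC_int (hgc j i) k), ← integral_div]
      congr 1
      funext y
      simp only [symG]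
      push_cast
      ring
    rw [this]
    ring
  rw [hβ _ (hgc i j), hA]
  simp_rw [hβ _ (hsc _ _), hE]
  exact key

lemma frob_nonneg {d : ℕ} (M : Fin d → Fin d → ℝ) : 0 ≤ frob M := Real.sqrt_nonneg _

lemma entry_le_frob {d : ℕ} (M : Fin d → Fin d → ℝ) (i j : Fin d) : |M i j| ≤ frob M := by
  refine Real.abs_le_sqrt ?_
  refine (Finset.single_le_sum (f := fun j => M i j ^ 2) (fun _ _ => sq_nonneg _)
    (Finset.mem_univ j)).trans ?_
  exact Finset.single_le_sum (f := fun i => ∑ j, M i j ^ 2)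
    (fun _ _ => Finset.sum_nonneg fun _ _ => sq_nonneg _) (Finset.mem_univ i)

lemma frob_le_sum {d : ℕ} (M : Fin d → Fin d → ℝ) : frob M ≤ ∑ p : Fin d × Fin d, |M p.1 p.2| := by
  unfold frob
  rw [Real.sqrt_le_left (Finset.sum_nonneg fun _ _ => abs_nonneg _), ← Finset.sum_product',
    Finset.univ_product_univ]
  have := Finset.sum_sq_le_sq_sum_of_nonneg (s := Finset.univ) (f := fun p : Fin d × Fin d => |M p.1 p.2|)
    (fun _ _ => abs_nonneg _)
  simpa using this

lemma frob_cont {d : ℕ} {M : (Fin d → ℝ) → Fin d → Fin d → ℝ} (h : ∀ i j, Continuous fun x => M x i j) :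
    Continuous fun x => frob (M x) := by
  unfold frob
  exact Real.continuous_sqrt.comp (continuous_finsetSum _ fun i _ => continuous_finsetSum _ fun j _ =>
    (h i j).pow 2)

theorem korn_frob (d : ℕ) {q : ℝ} (hq : 1 < q) : ∃ C : ℝ, 0 < C ∧
    ∀ u : (Fin d → ℝ) → (Fin d → ℝ), ContDiff ℝ (⊤ : ℕ∞) u → IsPer u →
    (∫ x in box d, frob (gradM u x) ^ q) ≤ C * ∫ x in box d, frob (symG u x) ^ q := by
  obtain ⟨C, hC, h⟩ := korn_entry d hq
  set N := (Fintype.card (Fin d × Fin d) : ℝ) with hN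
  refine ⟨N ^ (q - 1) * (N * (C * (d * (d * 1)))) + 1, by positivity, fun u hu hp => ?_⟩
  have hui : ∀ i, ContDiff ℝ (⊤ : ℕ∞) fun y => u y i := fun i => (contDiff_pi.1 hu) i
  have hgc : ∀ i j, Continuous fun x => gradM u x i j := fun i j =>
    ((hui i).continuous_fderiv (by simp)).clm_apply continuous_const
  have hsc : ∀ i j, Continuous fun x => symG u x i j := fun i j =>
    ((hgc i j).add (hgc j i)).div_const 2
  set D := ∫ x in box d, frob (symG u x) ^ q with hD
  have hD0 : 0 ≤ D := integral_nonneg fun x => Real.rpow_nonneg (frob_nonneg _) _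
  have hs : ∀ i j, II q (fun x => symG u x i j) ≤ D := fun i j =>
    integral_mono_of_nonneg (Filter.Eventually.of_forall fun _ => by positivity)
      ((frob_cont hsc).rpow_const fun _ => Or.inr (by linarith)).integrable_box
      (Filter.Eventually.of_forall fun x =>
        Real.rpow_le_rpow (abs_nonneg _) (entry_le_frob _ i j) (by linarith))
  have hg : ∀ p : Fin d × Fin d, II q (fun x => |gradM u x p.1 p.2|) ≤ C * (d * (d * 1)) * D := by
    intro p
    have e : II q (fun x => |gradM u x p.1 p.2|) = II q (fun x => gradM u x p.1 p.2) := by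
      unfold II; simp only [abs_abs]
    rw [e]
    refine (h u hu hp p.1 p.2).trans ?_
    rw [mul_assoc]
    gcongr
    calc ∑ i', ∑ j', II q (fun x => symG u x i' j') ≤ ∑ _i' : Fin d, ∑ _j' : Fin d, D :=
          Finset.sum_le_sum fun i _ => Finset.sum_le_sum fun j _ => hs i j
      _ = _ := by simp; ring
  have h1 := II_sum hq (fun (p : Fin d × Fin d) x => |gradM u x p.1 p.2|)
    (fun p => (hgc p.1 p.2).abs) hg
  have h2 : (∫ x in box d, frob (gradM u x) ^ q) ≤ II q (fun x => ∑ p : Fin d × Fin d, |gradM u x p.1 p.2|) := by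
    refine integral_mono_of_nonneg
      (Filter.Eventually.of_forall fun x => Real.rpow_nonneg (frob_nonneg _) _)
      (Continuous.integrable_box ?_) (Filter.Eventually.of_forall fun x => ?_)
    · exact ((continuous_finsetSum _ fun p _ => (hgc p.1 p.2).abs).abs).rpow_const
        fun _ => Or.inr (by linarith)
    · exact Real.rpow_le_rpow (frob_nonneg _) ((frob_le_sum _).trans (le_abs_self _)) (by linarith)
  rw [← hN] at h1
  refine h2.trans (h1.trans ?_)
  rw [add_mul, one_mul]
  refine le_add_of_le_of_nonneg (le_of_eq (by ring)) hD0


/-- Korn's inequality, periodic case. -/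
theorem stmt_3 (d : ℕ) (hd : 2 ≤ d) (q : ℝ) (hq : 1 < q) :
    ∃ ck > 0, ∀ u : (Fin d → ℝ) → (Fin d → ℝ),
      ContDiff ℝ (⊤ : ℕ∞) u → IsPer u → (∫ x in box d, u x) = 0 →
      ck * (∫ x in box d, frob (gradM u x) ^ q) ^ (1 / q)
        ≤ (∫ x in box d, frob (symG u x) ^ q) ^ (1 / q) := by
  obtain ⟨C, hC, h⟩ := korn_frob d hq
  refine ⟨(C ^ (1 / q))⁻¹, by positivity, fun u hu hp _ => ?_⟩
  have hD0 : 0 ≤ ∫ x in box d, frob (symG u x) ^ q :=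
    integral_nonneg fun x => Real.rpow_nonneg (frob_nonneg _) _
  have hG0 : 0 ≤ ∫ x in box d, frob (gradM u x) ^ q :=
    integral_nonneg fun x => Real.rpow_nonneg (frob_nonneg _) _
  have hpos : 0 < C ^ (1 / q) := by positivity
  rw [inv_mul_le_iff₀ hpos, ← Real.mul_rpow hC.le hD0]
  exact Real.rpow_le_rpow hG0 (h u hu hp) (by positivity)
end
end

section
/- Let d ∈ {2,3} and r ∈ [3,∞). There exists a constant c > 0, depending only on d and r, such that for every smooth 2π-periodic vector field u : ℝ^d → ℝ^d one has ∫_Ω |∇u(x)|³ dx ≤ c ( ∫_Ω |∇u(x)|^r dx )^{1/r} ∫_Ω |∇²u(x)|² dx, where |∇²u|² = ∑_{i,j,k} (∂_j∂_k u_i)². -/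
open MeasureTheory Real

noncomputable section

open scoped ENNReal NNReal

/-- The enlarged box `(-2π, 4π)^d`. -/
def bigBox (d : ℕ) : Set (Fin d → ℝ) := Set.univ.pi fun _ => Set.Ioo (-(2 * π)) (4 * π)

lemma IsPer.int {d : ℕ} {E : Type*} {g : (Fin d → ℝ) → E} (hg : IsPer g) (m : Fin d → ℤ) :
    Function.Periodic g (fun i => (m i : ℝ) * (2 * π)) := by
  have h1 : ∀ i, Function.Periodic g (m i • Pi.single i (2 * π)) := fun i =>
    Function.Periodic.zsmul (fun x => hg x i) (m i)
  have h2 : ∀ s : Finset (Fin d),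
      Function.Periodic g (∑ i ∈ s, m i • (Pi.single i (2 * π) : Fin d → ℝ)) := by
    intro s
    induction s using Finset.induction_on with
    | empty => intro x; simp
    | insert a s ha ih =>
      rw [Finset.sum_insert ha]
      exact (h1 a).add_period ih
  have h3 : (fun i => (m i : ℝ) * (2 * π)) =
      ∑ i, m i • (Pi.single i (2 * π) : Fin d → ℝ) := by
    funext j
    simp [Finset.sum_apply, Pi.single_apply]
  rw [h3]
  exact h2 _

lemma box_ae (d : ℕ) : (box d : Set (Fin d → ℝ)) =ᵐ[volume]
    (Set.univ.pi fun _ => Set.Ico 0 (2 * π) : Set (Fin d → ℝ)) := by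
  have h1 := Measure.univ_pi_Ioo_ae_eq_Icc (μ := fun _ : Fin d => (volume : Measure ℝ))
    (f := fun _ => 0) (g := fun _ => 2 * π)
  have h2 := Measure.univ_pi_Ico_ae_eq_Icc (μ := fun _ : Fin d => (volume : Measure ℝ))
    (f := fun _ => 0) (g := fun _ => 2 * π)
  exact h1.trans h2.symm

lemma tiling (d : ℕ) (G : (Fin d → ℝ) → ℝ≥0∞) (hG : IsPer G) :
    ∫⁻ x in bigBox d, G x ≤ (3 : ℝ≥0∞) ^ d * ∫⁻ x in box d, G x := by
  rw [setLIntegral_congr (box_ae d)]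
  set B0 : Set (Fin d → ℝ) := Set.univ.pi fun _ => Set.Ico 0 (2 * π) with hB0
  let m : (Fin d → Fin 3) → Fin d → ℤ := fun k i => (k i : ℤ) - 1
  let a : (Fin d → Fin 3) → Fin d → ℝ := fun k i => (m k i : ℝ) * (2 * π)
  have hpi : 0 < 2 * π := by positivity
  have hsub : bigBox d ⊆ ⋃ k : Fin d → Fin 3, (fun x => x + -(a k)) ⁻¹' B0 := by
    intro x hx
    have hx' : ∀ i, -(2 * π) < x i ∧ x i < 4 * π := by
      intro i; exact hx i (Set.mem_univ i)
    have : ∀ i, ∃ k : Fin 3, 0 ≤ x i - ((k : ℤ) - 1 : ℤ) * (2 * π) ∧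
        x i - ((k : ℤ) - 1 : ℤ) * (2 * π) < 2 * π := by
      intro i
      obtain ⟨h1, h2⟩ := hx' i
      rcases lt_or_ge (x i) 0 with h | h
      · exact ⟨0, by norm_num; linarith, by norm_num; linarith⟩
      · rcases lt_or_ge (x i) (2 * π) with h' | h'
        · exact ⟨1, by norm_num; linarith, by norm_num; linarith⟩
        · exact ⟨2, by norm_num; linarith, by norm_num; linarith⟩
    choose k hk using this
    refine Set.mem_iUnion.2 ⟨k, ?_⟩
    intro i _
    have := hk i
    simp only [a, m, Pi.add_apply, Pi.neg_apply, Set.mem_Ico]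
    constructor <;> linarith [this.1, this.2]
  have hshift : ∀ k, ∫⁻ x in (fun x => x + -(a k)) ⁻¹' B0, G x = ∫⁻ x in B0, G x := by
    intro k
    have hp : ∀ x, G (x + -(a k)) = G x := by
      intro x
      have := hG.int (m k) (x + -(a k))
      rw [← this]
      congr 1
      simp [a]
    have := (measurePreserving_add_right (volume : Measure (Fin d → ℝ)) (-(a k))).setLIntegral_comp_preimage_emb
      (measurableEmbedding_addRight (-(a k))) G B0
    simp only [hp] at this
    exact this
  calc ∫⁻ x in bigBox d, G x
      ≤ ∫⁻ x in ⋃ k : Fin d → Fin 3, (fun x => x + -(a k)) ⁻¹' B0, G x :=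
        lintegral_mono_set hsub
    _ ≤ ∑' k : Fin d → Fin 3, ∫⁻ x in (fun x => x + -(a k)) ⁻¹' B0, G x :=
        lintegral_iUnion_le _ _
    _ = (3 : ℝ≥0∞) ^ d * ∫⁻ x in B0, G x := by
        simp only [hshift]
        simp [tsum_fintype]

lemma sq_lintegral_le {α : Type*} [MeasurableSpace α] (μ : Measure α) (H : α → ℝ≥0∞)
    (hH : AEMeasurable H μ) : (∫⁻ s, H s ∂μ) ^ 2 ≤ μ Set.univ * ∫⁻ s, H s ^ 2 ∂μ := by
  have := ENNReal.lintegral_mul_le_Lp_mul_Lq μ Real.HolderConjugate.two_two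
    (f := fun _ => 1) (g := H) aemeasurable_const hH
  simp only [Pi.mul_apply, one_mul, lintegral_const, ENNReal.rpow_two, one_pow] at this
  calc (∫⁻ s, H s ∂μ) ^ 2
      ≤ ((μ Set.univ) ^ (1 / 2 : ℝ) * (∫⁻ s, H s ^ 2 ∂μ) ^ (1 / 2 : ℝ)) ^ 2 := by gcongr
    _ = _ := by
      rw [mul_pow, ← ENNReal.rpow_natCast, ← ENNReal.rpow_natCast, ← ENNReal.rpow_mul,
        ← ENNReal.rpow_mul]
      norm_num

lemma pointwise {d : ℕ} (v : (Fin d → ℝ) → ℝ) (hv : ContDiff ℝ (⊤ : ℕ∞) v) (hp : IsPer v)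
    (j : Fin d) (hf : ContDiff ℝ (⊤ : ℕ∞) (pd v j)) (x : Fin d → ℝ) :
    ‖pd v j x‖ₑ ≤ ∫⁻ s in Set.Ioo 0 (2 * π),
      ‖fderiv ℝ (pd v j) (x + s • Pi.single j 1)‖ₑ := by
  set e : Fin d → ℝ := Pi.single j 1 with he
  have hpi : 0 < 2 * π := by positivity
  have hl : ∀ s : ℝ, HasDerivAt (fun s : ℝ => x + s • e) e s := by
    intro s
    have := ((hasDerivAt_id s).smul_const e).const_add x
    simpa using this
  have h1 : ∀ s : ℝ, HasDerivAt (fun s : ℝ => v (x + s • e)) (pd v j (x + s • e)) s := by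
    intro s
    exact ((hv.differentiable (by simp) _).hasFDerivAt).comp_hasDerivAt s (hl s)
  have h2 : ∀ s : ℝ, HasDerivAt (fun s : ℝ => pd v j (x + s • e))
      (fderiv ℝ (pd v j) (x + s • e) e) s := by
    intro s
    exact ((hf.differentiable (by simp) _).hasFDerivAt).comp_hasDerivAt s (hl s)
  have hcf : Continuous (fderiv ℝ (pd v j)) := hf.continuous_fderiv (by simp)
  have hc : Continuous fun s : ℝ => fderiv ℝ (pd v j) (x + s • e) e := by fun_prop
  obtain ⟨s0, hs0, hz⟩ := exists_hasDerivAt_eq_zero (f := fun s : ℝ => v (x + s • e))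
    (f' := fun s => pd v j (x + s • e)) hpi
    (fun s _ => (h1 s).continuousAt.continuousWithinAt)
    (by
      have : (2 * π) • e = Pi.single j (2 * π) := by
        rw [he, ← Pi.single_smul]; simp
      show v (x + (0 : ℝ) • e) = v (x + (2 * π) • e)
      rw [this, hp x j]; simp)
    (fun s _ => h1 s)
  have hFTC := intervalIntegral.integral_eq_sub_of_hasDerivAt (a := 0) (b := s0)
    (fun s _ => h2 s) (hc.intervalIntegrable _ _)
  simp only [hz] at hFTC
  have hx : pd v j x = - ∫ s in (0:ℝ)..s0, fderiv ℝ (pd v j) (x + s • e) e := by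
    rw [hFTC]; simp
  have hne : ‖e‖ ≤ 1 := by
    rw [pi_norm_le_iff_of_nonneg zero_le_one]
    intro i
    by_cases h : i = j
    · subst h; simp [he]
    · simp [he, h]
  rw [hx, enorm_neg, intervalIntegral.integral_of_le hs0.1.le]
  calc ‖∫ s in Set.Ioc 0 s0, fderiv ℝ (pd v j) (x + s • e) e‖ₑ
      ≤ ∫⁻ s in Set.Ioc 0 s0, ‖fderiv ℝ (pd v j) (x + s • e) e‖ₑ :=
        enorm_integral_le_lintegral_enorm _
    _ ≤ ∫⁻ s in Set.Ioc 0 s0, ‖fderiv ℝ (pd v j) (x + s • e)‖ₑ := by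
        refine lintegral_mono fun s => ?_
        rw [enorm_le_iff_norm_le]
        exact (ContinuousLinearMap.le_opNorm _ _).trans
          (mul_le_of_le_one_right (norm_nonneg _) hne)
    _ ≤ _ := by
        refine lintegral_mono_set ?_
        intro s hs
        exact ⟨hs.1, hs.2.trans_lt hs0.2⟩

lemma IsPer.fderiv {d : ℕ} {f : (Fin d → ℝ) → ℝ} (hf : IsPer f) :
    IsPer (fderiv ℝ f) := by
  intro x i
  rw [← fderiv_comp_add_right]
  congr 1
  funext y
  exact hf y i

lemma poincare {d : ℕ} (v : (Fin d → ℝ) → ℝ) (hv : ContDiff ℝ (⊤ : ℕ∞) v) (hp : IsPer v)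
    (j : Fin d) (hf : ContDiff ℝ (⊤ : ℕ∞) (pd v j)) (hfp : IsPer (pd v j)) :
    ∫⁻ x in box d, ‖pd v j x‖ₑ ^ 2 ≤
      ENNReal.ofReal (2 * π) * (ENNReal.ofReal (2 * π) *
        (3 ^ d * ∫⁻ x in box d, ‖fderiv ℝ (pd v j) x‖ₑ ^ 2)) := by
  set e : Fin d → ℝ := Pi.single j 1 with he
  have hcf : Continuous (fderiv ℝ (pd v j)) := hf.continuous_fderiv (by simp)
  set G : (Fin d → ℝ) → ℝ≥0∞ := fun x => ‖fderiv ℝ (pd v j) x‖ₑ ^ 2 with hG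
  have hGc : Continuous G := by fun_prop
  have hGp : IsPer G := fun x i => by simp only [hG, hfp.fderiv x i]
  have h1 : ∀ x, ‖pd v j x‖ₑ ^ 2 ≤
      ENNReal.ofReal (2 * π) * ∫⁻ s in Set.Ioo 0 (2 * π), G (x + s • e) := by
    intro x
    calc ‖pd v j x‖ₑ ^ 2 ≤ (∫⁻ s in Set.Ioo 0 (2 * π),
          ‖fderiv ℝ (pd v j) (x + s • e)‖ₑ) ^ 2 := by
            gcongr; exact pointwise v hv hp j hf x
      _ ≤ _ := sq_lintegral_le _ _ (by
            apply Continuous.aemeasurable; fun_prop)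
      _ = _ := by simp [hG]
  have h2 : ∀ s ∈ Set.Ioo 0 (2 * π), ∫⁻ x in box d, G (x + s • e) ≤ ∫⁻ x in bigBox d, G x := by
    intro s hs
    have := (measurePreserving_add_right (volume : Measure (Fin d → ℝ))
      (s • e)).setLIntegral_comp_preimage_emb
      (measurableEmbedding_addRight (s • e)) G (bigBox d)
    rw [← this]
    refine lintegral_mono_set ?_
    intro x hx i _
    have hxi := hx i (Set.mem_univ i)
    have hs1 := hs.1
    have hs2 := hs.2
    have : 0 ≤ e i ∧ e i ≤ 1 := by
      rw [he]; by_cases h : i = j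
      · subst h; simp
      · simp [h]
    simp only [Set.mem_Ioo, Pi.add_apply, Pi.smul_apply, smul_eq_mul] at hxi ⊢
    constructor <;> nlinarith [pi_pos]
  calc ∫⁻ x in box d, ‖pd v j x‖ₑ ^ 2
      ≤ ∫⁻ x in box d, ENNReal.ofReal (2 * π) * ∫⁻ s in Set.Ioo 0 (2 * π), G (x + s • e) :=
        lintegral_mono h1
    _ = ENNReal.ofReal (2 * π) * ∫⁻ x in box d, ∫⁻ s in Set.Ioo 0 (2 * π), G (x + s • e) :=
        lintegral_const_mul' _ _ ENNReal.ofReal_ne_top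
    _ = ENNReal.ofReal (2 * π) * ∫⁻ s in Set.Ioo 0 (2 * π), ∫⁻ x in box d, G (x + s • e) := by
        rw [lintegral_lintegral_swap]
        apply Continuous.aemeasurable
        simp only [Function.uncurry_def]
        fun_prop
    _ ≤ ENNReal.ofReal (2 * π) * ∫⁻ s in Set.Ioo 0 (2 * π), ∫⁻ x in bigBox d, G x := by
        gcongr 1
        exact setLIntegral_mono' measurableSet_Ioo h2
    _ = ENNReal.ofReal (2 * π) * (ENNReal.ofReal (2 * π) * ∫⁻ x in bigBox d, G x) := by
        rw [setLIntegral_const, Real.volume_Ioo, sub_zero, mul_comm (∫⁻ x in bigBox d, G x)]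
    _ ≤ _ := by
        gcongr
        exact tiling d G hGp

lemma eLpNorm_two_eq {α E : Type*} [MeasurableSpace α] [NormedAddCommGroup E] (μ : Measure α)
    (F : α → E) : eLpNorm F 2 μ = (∫⁻ x, ‖F x‖ₑ ^ 2 ∂μ) ^ (1 / 2 : ℝ) := by
  rw [eLpNorm_eq_lintegral_rpow_enorm_toReal (by simp) (by simp)]
  simp

lemma tiling_norm {d : ℕ} {E : Type*} [NormedAddCommGroup E] (F : (Fin d → ℝ) → E)
    (hF : IsPer F) : eLpNorm F 2 (volume.restrict (bigBox d)) ≤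
      ((3 : ℝ≥0∞) ^ d) ^ (1 / 2 : ℝ) * eLpNorm F 2 (volume.restrict (box d)) := by
  rw [eLpNorm_two_eq, eLpNorm_two_eq, ← ENNReal.mul_rpow_of_nonneg _ _ (by norm_num)]
  gcongr
  exact tiling d _ (fun x i => by simp only [hF x i])

lemma poincare_norm {d : ℕ} (v : (Fin d → ℝ) → ℝ) (hv : ContDiff ℝ (⊤ : ℕ∞) v) (hp : IsPer v)
    (j : Fin d) (hf : ContDiff ℝ (⊤ : ℕ∞) (pd v j)) (hfp : IsPer (pd v j)) :
    eLpNorm (pd v j) 2 (volume.restrict (box d)) ≤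
      (ENNReal.ofReal (2 * π) * ENNReal.ofReal (2 * π) * 3 ^ d) ^ (1 / 2 : ℝ) *
        eLpNorm (fderiv ℝ (pd v j)) 2 (volume.restrict (box d)) := by
  rw [eLpNorm_two_eq, eLpNorm_two_eq, ← ENNReal.mul_rpow_of_nonneg _ _ (by norm_num)]
  gcongr
  refine (poincare v hv hp j hf hfp).trans (le_of_eq ?_)
  ring

lemma measure_bigBox (d : ℕ) : volume (bigBox d) ≠ ⊤ := by
  simp only [bigBox, Real.volume_pi_Ioo]
  exact ENNReal.prod_ne_top (fun _ _ => ENNReal.ofReal_ne_top)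

lemma measure_box (d : ℕ) : volume (box d) ≠ ⊤ := by
  simp only [box, Real.volume_pi_Ioo]
  exact ENNReal.prod_ne_top (fun _ _ => ENNReal.ofReal_ne_top)

lemma sobolev (d : ℕ) (hd : d = 2 ∨ d = 3) : ∃ C : ℝ≥0∞, C ≠ ⊤ ∧
    ∀ f : (Fin d → ℝ) → ℝ, ContDiff ℝ (⊤ : ℕ∞) f → IsPer f →
      eLpNorm f 3 (volume.restrict (box d)) ≤ C * (eLpNorm f 2 (volume.restrict (box d)) +
        eLpNorm (fderiv ℝ f) 2 (volume.restrict (box d))) := by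
  have hpi := pi_pos
  let c : Fin d → ℝ := fun _ => π
  let φ : ContDiffBump c := ⟨π, 2 * π, hpi, by linarith⟩
  have hφ : ContDiff ℝ (⊤ : ℕ∞) φ := φ.contDiff
  have hφc : HasCompactSupport φ := φ.hasCompactSupport
  obtain ⟨K, hK⟩ := (hφc.fderiv (𝕜 := ℝ)).exists_bound_of_continuous
    (hφ.continuous_fderiv (by simp))
  have hK0 : 0 ≤ K := (norm_nonneg _).trans (hK 0)
  have hmeas : MeasurableSet (bigBox d) :=
    MeasurableSet.univ_pi (fun _ => measurableSet_Ioo)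
  have hmeas' : MeasurableSet (box d) :=
    MeasurableSet.univ_pi (fun _ => measurableSet_Ioo)
  have hone : ∀ x ∈ box d, φ x = 1 := by
    intro x hx
    apply φ.one_of_mem_closedBall
    rw [Metric.mem_closedBall, dist_pi_le_iff hpi.le]
    intro i
    have := hx i (Set.mem_univ i)
    rw [Real.dist_eq, abs_le]
    constructor <;> simp only [c] <;> linarith [this.1, this.2]
  have hbig : Metric.closedBall c (2 * π) ⊆ bigBox d := by
    intro x hx i _
    rw [Metric.mem_closedBall, dist_pi_le_iff (by positivity)] at hx
    have := hx i
    rw [Real.dist_eq, abs_le] at this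
    simp only [c] at this
    constructor <;> linarith [this.1, this.2]
  set V := volume (bigBox d) with hV
  set C0 : ℝ≥0 := eLpNormLESNormFDerivOfLeConst ℝ (volume : Measure (Fin d → ℝ))
    (Metric.ball c (2 * π)) (3 / 2 : ℝ≥0) 3 with hC0
  refine ⟨(C0 : ℝ≥0∞) * (V ^ ((1 : ℝ) / (3 / 2) - 1 / 2)) * ((ENNReal.ofReal K + 1) *
    ((3 : ℝ≥0∞) ^ d) ^ (1 / 2 : ℝ)), ?_, ?_⟩
  · refine ENNReal.mul_ne_top (ENNReal.mul_ne_top ENNReal.coe_ne_top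
      (ENNReal.rpow_ne_top_of_nonneg (by norm_num) (measure_bigBox d)))
      (ENNReal.mul_ne_top (by simp) (ENNReal.rpow_ne_top_of_nonneg (by norm_num) (by simp)))
  intro f hf hfp
  have hcf : Continuous (fderiv ℝ f) := hf.continuous_fderiv (by simp)
  let h : (Fin d → ℝ) → ℝ := fun x => φ x * f x
  have hh : ContDiff ℝ (⊤ : ℕ∞) h := hφ.mul hf
  have hch : Continuous (fderiv ℝ h) := hh.continuous_fderiv (by simp)
  have hsupp : Function.support h ⊆ Metric.ball c (2 * π) := by
    intro x hx
    have : φ x ≠ 0 := fun h0 => hx (by simp [h, h0])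
    have h2 : x ∈ Function.support φ := this
    rwa [φ.support_eq] at h2
  have hgns := eLpNorm_le_eLpNorm_fderiv_of_le (F := ℝ) (μ := (volume : Measure (Fin d → ℝ)))
    (p := (3 / 2 : ℝ≥0)) (q := 3) (hh.of_le (by simp)) hsupp
    (by rw [← NNReal.coe_le_coe]; norm_num)
    (by rw [← NNReal.coe_lt_coe]; rcases hd with rfl | rfl <;> simp <;> norm_num)
    (by rcases hd with rfl | rfl <;> simp <;> norm_num) Metric.isBounded_ball
  have hDsupp : Function.support (fderiv ℝ h) ⊆ bigBox d := by
    refine (subset_tsupport _).trans ((tsupport_fderiv_subset ℝ).trans (Set.Subset.trans ?_ hbig))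
    exact closure_minimal (hsupp.trans Metric.ball_subset_closedBall) Metric.isClosed_closedBall
  have hDb : ∀ x, ‖fderiv ℝ h x‖ ≤ K * ‖f x‖ + ‖fderiv ℝ f x‖ := by
    intro x
    have : fderiv ℝ h x = φ x • fderiv ℝ f x + f x • fderiv ℝ φ x :=
      fderiv_fun_mul (hφ.differentiable (by simp) x) (hf.differentiable (by simp) x)
    rw [this]
    refine (norm_add_le _ _).trans ?_
    rw [norm_smul, norm_smul, add_comm]
    have h1 : ‖φ x‖ ≤ 1 := by
      rw [Real.norm_of_nonneg φ.nonneg]; exact φ.le_one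
    have h2 := hK x
    have h3 := norm_nonneg (f x)
    have h4 := norm_nonneg (fderiv ℝ f x)
    nlinarith
  set R := volume.restrict (bigBox d) with hR
  set Q := volume.restrict (box d) with hQ
  have s1 : eLpNorm f 3 Q ≤ eLpNorm h 3 volume := by
    calc eLpNorm f 3 Q = eLpNorm h 3 Q := by
          apply eLpNorm_congr_ae
          filter_upwards [ae_restrict_mem hmeas'] with x hx
          simp [h, hone x hx]
      _ ≤ _ := eLpNorm_mono_measure _ Measure.restrict_le_self
  have s2 : eLpNorm (fderiv ℝ h) ((3 / 2 : ℝ≥0) : ℝ≥0∞) volume ≤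
      eLpNorm (fderiv ℝ h) 2 R * V ^ ((1 : ℝ) / (3 / 2) - 1 / 2) := by
    have e1 : eLpNorm (fderiv ℝ h) ((3 / 2 : ℝ≥0) : ℝ≥0∞) volume =
        eLpNorm (fderiv ℝ h) ((3 / 2 : ℝ≥0) : ℝ≥0∞) R := by
      rw [hR, ← eLpNorm_indicator_eq_eLpNorm_restrict (f := fderiv ℝ h) hmeas,
        Set.indicator_eq_self.2 hDsupp]
    rw [e1]
    have := eLpNorm_le_eLpNorm_mul_rpow_measure_univ (μ := R) (f := fderiv ℝ h)
      (p := ((3 / 2 : ℝ≥0) : ℝ≥0∞)) (q := 2)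
      (by
        rw [show (2 : ℝ≥0∞) = ((2 : ℝ≥0) : ℝ≥0∞) from rfl, ENNReal.coe_le_coe,
          ← NNReal.coe_le_coe]
        norm_num)
      hch.aestronglyMeasurable
    simpa [hR, hV] using this
  have s3 : eLpNorm (fderiv ℝ h) 2 R ≤ ENNReal.ofReal K * eLpNorm f 2 R +
      eLpNorm (fderiv ℝ f) 2 R := by
    calc eLpNorm (fderiv ℝ h) 2 R
        ≤ eLpNorm ((fun x => K * ‖f x‖) + fun x => ‖fderiv ℝ f x‖) 2 R :=
          eLpNorm_mono_real hDb
      _ ≤ eLpNorm (fun x => K * ‖f x‖) 2 R + eLpNorm (fun x => ‖fderiv ℝ f x‖) 2 R := by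
          have := hf.continuous
          exact eLpNorm_add_le (Continuous.aestronglyMeasurable (by fun_prop))
            (Continuous.aestronglyMeasurable (by fun_prop)) (by norm_num)
      _ = _ := by
          rw [eLpNorm_norm]
          congr 1
          have := eLpNorm_const_smul K (fun x => ‖f x‖) 2 R
          rw [eLpNorm_norm, Real.enorm_of_nonneg hK0] at this
          exact this
  have s4 := tiling_norm f hfp
  have s5 := tiling_norm (fderiv ℝ f) hfp.fderiv
  set T := ((3 : ℝ≥0∞) ^ d) ^ (1 / 2 : ℝ)
  calc eLpNorm f 3 Q ≤ eLpNorm h 3 volume := s1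
    _ ≤ C0 * eLpNorm (fderiv ℝ h) ((3 / 2 : ℝ≥0) : ℝ≥0∞) volume := hgns
    _ ≤ C0 * ((ENNReal.ofReal K * (T * eLpNorm f 2 Q) + T * eLpNorm (fderiv ℝ f) 2 Q) *
          V ^ ((1 : ℝ) / (3 / 2) - 1 / 2)) := by
        gcongr
        refine s2.trans ?_
        gcongr
        refine s3.trans ?_
        gcongr
    _ ≤ C0 * (((ENNReal.ofReal K + 1) * (T * eLpNorm f 2 Q) +
          (ENNReal.ofReal K + 1) * (T * eLpNorm (fderiv ℝ f) 2 Q)) *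
          V ^ ((1 : ℝ) / (3 / 2) - 1 / 2)) := by
        have k1 : T * eLpNorm (fderiv ℝ f) 2 Q ≤
            (ENNReal.ofReal K + 1) * (T * eLpNorm (fderiv ℝ f) 2 Q) :=
          le_mul_of_one_le_left' le_add_self
        have k2 : ENNReal.ofReal K ≤ ENNReal.ofReal K + 1 := le_self_add
        exact mul_le_mul_right (mul_le_mul_left (add_le_add (mul_le_mul_left k2 _) k1) _) _
    _ = _ := by ring

lemma pd_smooth {d : ℕ} {v : (Fin d → ℝ) → ℝ} (hv : ContDiff ℝ (⊤ : ℕ∞) v) (j : Fin d) :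
    ContDiff ℝ (⊤ : ℕ∞) (pd v j) := by
  have h : ContDiff ℝ (⊤ : ℕ∞) (fderiv ℝ v) := hv.fderiv_right (by simp)
  exact h.clm_apply contDiff_const

lemma pd_per {d : ℕ} {v : (Fin d → ℝ) → ℝ} (hv : IsPer v) (j : Fin d) : IsPer (pd v j) := by
  intro x i
  simp only [pd, hv.fderiv x i]

lemma norm_fderiv_le {d : ℕ} (f : (Fin d → ℝ) → ℝ) (x : Fin d → ℝ) :
    ‖fderiv ℝ f x‖ ≤ ∑ k, |pd f k x| := by
  refine ContinuousLinearMap.opNorm_le_bound _ (Finset.sum_nonneg fun _ _ => abs_nonneg _) ?_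
  intro y
  have h0 := LinearMap.pi_apply_eq_sum_univ (fderiv ℝ f x).toLinearMap y
  rw [ContinuousLinearMap.coe_coe] at h0
  rw [h0, Finset.sum_mul]
  refine (norm_sum_le _ _).trans (Finset.sum_le_sum fun k _ => ?_)
  rw [norm_smul, mul_comm]
  have h1 : (fun j => if k = j then (1 : ℝ) else 0) = Pi.single k 1 := by
    funext j; simp [Pi.single_apply, eq_comm]
  have h2 := norm_le_pi_norm y k
  simp only [h1]
  exact mul_le_mul_of_nonneg_left h2 (abs_nonneg _)

lemma cont_memLp {d : ℕ} {g : (Fin d → ℝ) → ℝ} (hg : Continuous g) (p : ℝ≥0∞) :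
    MemLp g p (volume.restrict (box d)) := by
  have hmeas' : MeasurableSet (box d) :=
    MeasurableSet.univ_pi (fun _ => measurableSet_Ioo)
  have : IsFiniteMeasure (volume.restrict (box d)) :=
    ⟨by rw [Measure.restrict_apply_univ]; exact (measure_box d).lt_top⟩
  obtain ⟨K, hK⟩ := (isCompact_univ_pi (X := fun _ : Fin d => ℝ)
    (s := fun _ => Set.Icc 0 (2 * π)) (fun _ => isCompact_Icc)).exists_bound_of_continuousOn
    hg.continuousOn
  refine MemLp.of_bound hg.aestronglyMeasurable K ?_
  filter_upwards [ae_restrict_mem hmeas'] with x hx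
  exact hK x (fun i hi => Set.Ioo_subset_Icc_self (hx i hi))

/-- Root of the sum of squares of all second derivatives. -/
def hessN {d : ℕ} (u : (Fin d → ℝ) → (Fin d → ℝ)) (x : Fin d → ℝ) : ℝ :=
  Real.sqrt (∑ i, ∑ j, ∑ k, pd (pd (fun y => u y i) k) j x ^ 2)

lemma abs_le_hessN {d : ℕ} (u : (Fin d → ℝ) → (Fin d → ℝ)) (x : Fin d → ℝ) (i j k : Fin d) :
    |pd (pd (fun y => u y i) k) j x| ≤ hessN u x := by
  apply Real.abs_le_sqrt
  have h1 := Finset.single_le_sum (f := fun k => pd (pd (fun y => u y i) k) j x ^ 2)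
    (fun _ _ => sq_nonneg _) (Finset.mem_univ k)
  have h2 := Finset.single_le_sum (f := fun j => ∑ k, pd (pd (fun y => u y i) k) j x ^ 2)
    (fun _ _ => Finset.sum_nonneg fun _ _ => sq_nonneg _) (Finset.mem_univ j)
  have h3 := Finset.single_le_sum (f := fun i => ∑ j, ∑ k, pd (pd (fun y => u y i) k) j x ^ 2)
    (fun _ _ => Finset.sum_nonneg fun _ _ => Finset.sum_nonneg fun _ _ => sq_nonneg _)
    (Finset.mem_univ i)
  exact h1.trans (h2.trans h3)

lemma frob_le {d : ℕ} (M : Fin d → Fin d → ℝ) : frob M ≤ ∑ i, ∑ j, |M i j| := by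
  apply Real.sqrt_le_iff.2
  have hn : ∀ i, 0 ≤ ∑ j, |M i j| := fun i => Finset.sum_nonneg fun _ _ => abs_nonneg _
  refine ⟨Finset.sum_nonneg fun i _ => hn i, ?_⟩
  refine le_trans ?_ (Finset.sum_sq_le_sq_sum_of_nonneg fun i _ => hn i)
  refine Finset.sum_le_sum fun i _ => ?_
  refine le_trans ?_ (Finset.sum_sq_le_sq_sum_of_nonneg fun j _ => abs_nonneg _)
  simp

lemma main_bound (d : ℕ) (hd : d = 2 ∨ d = 3) : ∃ C : ℝ≥0∞, C ≠ ⊤ ∧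
    ∀ u : (Fin d → ℝ) → (Fin d → ℝ), ContDiff ℝ (⊤ : ℕ∞) u → IsPer u →
      eLpNorm (fun x => frob (gradM u x)) 3 (volume.restrict (box d)) ≤
        C * eLpNorm (hessN u) 2 (volume.restrict (box d)) := by
  obtain ⟨C, hC, hS⟩ := sobolev d hd
  set A := (ENNReal.ofReal (2 * π) * ENNReal.ofReal (2 * π) * 3 ^ d) ^ (1 / 2 : ℝ) with hA
  have hA' : A ≠ ⊤ := ENNReal.rpow_ne_top_of_nonneg (by norm_num)
    (ENNReal.mul_ne_top (ENNReal.mul_ne_top ENNReal.ofReal_ne_top ENNReal.ofReal_ne_top)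
      (by simp))
  refine ⟨d * (d * (C * ((A + 1) * d))), ?_, ?_⟩
  · have hd' : (d : ℝ≥0∞) ≠ ⊤ := ENNReal.natCast_ne_top d
    exact ENNReal.mul_ne_top hd' (ENNReal.mul_ne_top hd' (ENNReal.mul_ne_top hC
      (ENNReal.mul_ne_top (by simp [hA']) hd')))
  intro u hu hup
  set Q := volume.restrict (box d) with hQ
  have hv : ∀ i, ContDiff ℝ (⊤ : ℕ∞) (fun y => u y i) := fun i => contDiff_pi.1 hu i
  have hvp : ∀ i, IsPer (fun y => u y i) := fun i x j => congrFun (hup x j) i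
  have hone : ∀ i j, eLpNorm (fun x => |gradM u x i j|) 3 Q ≤
      C * ((A + 1) * d) * eLpNorm (hessN u) 2 Q := by
    intro i j
    have hf := pd_smooth (hv i) j
    have hfp := pd_per (hvp i) j
    have h1 := hS _ hf hfp
    have h2 := poincare_norm _ (hv i) (hvp i) j hf hfp
    have h3 : eLpNorm (fderiv ℝ (pd (fun y => u y i) j)) 2 Q ≤ d * eLpNorm (hessN u) 2 Q := by
      calc eLpNorm (fderiv ℝ (pd (fun y => u y i) j)) 2 Q
          ≤ eLpNorm ((d : ℝ) • hessN u) 2 Q := by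
            apply eLpNorm_mono_real
            intro x
            refine (norm_fderiv_le _ x).trans ?_
            refine (Finset.sum_le_sum fun k _ => abs_le_hessN u x i k j).trans ?_
            simp
        _ = _ := by
            rw [eLpNorm_const_smul]; simp
    have h0 : eLpNorm (fun x => |gradM u x i j|) 3 Q = eLpNorm (pd (fun y => u y i) j) 3 Q := by
      rw [← eLpNorm_norm (pd (fun y => u y i) j)]
      rfl
    rw [h0]
    calc eLpNorm (pd (fun y => u y i) j) 3 Q
        ≤ C * (eLpNorm (pd (fun y => u y i) j) 2 Q +
          eLpNorm (fderiv ℝ (pd (fun y => u y i) j)) 2 Q) := h1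
      _ ≤ C * (A * (d * eLpNorm (hessN u) 2 Q) + d * eLpNorm (hessN u) 2 Q) := by
          gcongr
          refine h2.trans ?_
          gcongr
      _ = _ := by ring
  have hcont : ∀ i j, Continuous fun x => |gradM u x i j| := fun i j =>
    (pd_smooth (hv i) j).continuous.abs
  calc eLpNorm (fun x => frob (gradM u x)) 3 Q
      ≤ eLpNorm (∑ i, ∑ j, fun x => |gradM u x i j|) 3 Q := by
        apply eLpNorm_mono_real
        intro x
        rw [Real.norm_of_nonneg (show 0 ≤ frob (gradM u x) from Real.sqrt_nonneg _)]
        simpa using frob_le (gradM u x)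
    _ ≤ ∑ i, eLpNorm (∑ j, fun x => |gradM u x i j|) 3 Q := by
        apply eLpNorm_sum_le
        · intro i _
          apply Continuous.aestronglyMeasurable
          have : (∑ j, fun x => |gradM u x i j|) = fun x => ∑ j, |gradM u x i j| := by
            funext x; simp
          rw [this]
          exact continuous_finsetSum _ fun j _ => hcont i j
        · norm_num
    _ ≤ ∑ i : Fin d, ∑ j : Fin d, C * ((A + 1) * d) * eLpNorm (hessN u) 2 Q := by
        refine Finset.sum_le_sum fun i _ => ?_
        refine (eLpNorm_sum_le (fun j _ => (hcont i j).aestronglyMeasurable)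
          (by norm_num)).trans ?_
        exact Finset.sum_le_sum fun j _ => hone i j
    _ = _ := by
        simp; ring

/-- interpolation estimate `‖∇u‖³_{L³} ≤ c ‖∇u‖_{L^r} ‖∇²u‖²_{L²}`. -/
theorem stmt_15 (d : ℕ) (hd : d = 2 ∨ d = 3) (r : ℝ) (hr : 3 ≤ r) :
    ∃ c > 0, ∀ u : (Fin d → ℝ) → (Fin d → ℝ),
      ContDiff ℝ (⊤ : ℕ∞) u → IsPer u →
      ∫ x in box d, frob (gradM u x) ^ 3
        ≤ c * (∫ x in box d, frob (gradM u x) ^ r) ^ (1 / r)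
            * ∫ x in box d, ∑ i, ∑ j, ∑ k, pd (pd (fun y => u y i) k) j x ^ 2 := by
  obtain ⟨C, hC, hS⟩ := main_bound d hd
  set Q := volume.restrict (box d) with hQ
  have hr0 : 0 < r := by linarith
  have hinv : 0 ≤ 1 / 3 - 1 / r := by
    rw [sub_nonneg]
    exact one_div_le_one_div_of_le (by norm_num) hr
  set W : ℝ≥0∞ := volume (box d) ^ (1 / 3 - 1 / r) with hW
  have hW' : W ≠ ⊤ := ENNReal.rpow_ne_top_of_nonneg hinv (measure_box d)
  refine ⟨(W * C ^ 2).toReal + 1, by positivity, ?_⟩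
  intro u hu hup
  have hv : ∀ i, ContDiff ℝ (⊤ : ℕ∞) (fun y => u y i) := fun i => contDiff_pi.1 hu i
  set g : (Fin d → ℝ) → ℝ := fun x => frob (gradM u x) with hg
  have hgc : Continuous g := by
    refine Real.continuous_sqrt.comp (continuous_finsetSum _ fun i _ =>
      continuous_finsetSum _ fun j _ => ?_)
    exact (pd_smooth (hv i) j).continuous.pow 2
  have hHc : Continuous (hessN u) := by
    refine Real.continuous_sqrt.comp (continuous_finsetSum _ fun i _ =>
      continuous_finsetSum _ fun j _ => continuous_finsetSum _ fun k _ => ?_)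
    exact (pd_smooth (pd_smooth (hv i) k) j).continuous.pow 2
  have hg0 : ∀ x, 0 ≤ g x := fun x => Real.sqrt_nonneg _
  have n3 := cont_memLp hgc 3
  have nr := cont_memLp hgc (ENNReal.ofReal r)
  have nH := cont_memLp hHc 2
  have e3 := n3.eLpNorm_eq_integral_rpow_norm (by simp) (by simp)
  have er := nr.eLpNorm_eq_integral_rpow_norm (by simpa using hr0) (by simp)
  have eH := nH.eLpNorm_eq_integral_rpow_norm (by simp) (by simp)
  have b1 := hS u hu hup
  have b2 : eLpNorm g 3 Q ≤ eLpNorm g (ENNReal.ofReal r) Q * W := by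
    have := eLpNorm_le_eLpNorm_mul_rpow_measure_univ (μ := Q) (f := g)
      (p := 3) (q := ENNReal.ofReal r)
      (by rw [show (3 : ℝ≥0∞) = ENNReal.ofReal 3 by simp]; exact ENNReal.ofReal_le_ofReal hr)
      hgc.aestronglyMeasurable
    simpa [hQ, hW, ENNReal.toReal_ofReal hr0.le] using this
  have b3 : (eLpNorm g 3 Q) ^ 3 ≤
      W * C ^ 2 * (eLpNorm g (ENNReal.ofReal r) Q * eLpNorm (hessN u) 2 Q ^ 2) := by
    calc (eLpNorm g 3 Q) ^ 3 = eLpNorm g 3 Q * eLpNorm g 3 Q ^ 2 := by ring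
      _ ≤ (eLpNorm g (ENNReal.ofReal r) Q * W) * (C * eLpNorm (hessN u) 2 Q) ^ 2 := by
        gcongr
      _ = _ := by ring
  have i3 : (eLpNorm g 3 Q).toReal ^ 3 = ∫ x in box d, g x ^ 3 := by
    have hn : 0 ≤ ∫ x in box d, g x ^ 3 := integral_nonneg fun x => pow_nonneg (hg0 x) 3
    have he : ∫ x in box d, ‖g x‖ ^ (3 : ℝ≥0∞).toReal = ∫ x in box d, g x ^ 3 := by
      congr 1; funext x
      rw [Real.norm_of_nonneg (hg0 x)]
      rw [ENNReal.toReal_ofNat]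
      exact_mod_cast Real.rpow_natCast (g x) 3
    rw [e3, he, ENNReal.toReal_ofReal (by positivity), ← Real.rpow_natCast, ← Real.rpow_mul hn]
    norm_num
  have ir : (eLpNorm g (ENNReal.ofReal r) Q).toReal = (∫ x in box d, g x ^ r) ^ (1 / r) := by
    have hn : 0 ≤ ∫ x in box d, g x ^ r := integral_nonneg fun x => Real.rpow_nonneg (hg0 x) r
    have he : ∫ x in box d, ‖g x‖ ^ (ENNReal.ofReal r).toReal = ∫ x in box d, g x ^ r := by
      congr 1; funext x
      rw [Real.norm_of_nonneg (hg0 x), ENNReal.toReal_ofReal hr0.le]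
    rw [er, he, ENNReal.toReal_ofReal (by positivity), ENNReal.toReal_ofReal hr0.le, one_div]
  have iH : (eLpNorm (hessN u) 2 Q).toReal ^ 2 =
      ∫ x in box d, ∑ i, ∑ j, ∑ k, pd (pd (fun y => u y i) k) j x ^ 2 := by
    have hsn : ∀ x, 0 ≤ ∑ i, ∑ j, ∑ k, pd (pd (fun y => u y i) k) j x ^ 2 := fun x =>
      Finset.sum_nonneg fun _ _ => Finset.sum_nonneg fun _ _ => Finset.sum_nonneg fun _ _ =>
        sq_nonneg _
    have hn : 0 ≤ ∫ x in box d, ∑ i, ∑ j, ∑ k, pd (pd (fun y => u y i) k) j x ^ 2 :=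
      integral_nonneg hsn
    have he : ∫ x in box d, ‖hessN u x‖ ^ (2 : ℝ≥0∞).toReal =
        ∫ x in box d, ∑ i, ∑ j, ∑ k, pd (pd (fun y => u y i) k) j x ^ 2 := by
      congr 1; funext x
      rw [Real.norm_of_nonneg (show 0 ≤ hessN u x from Real.sqrt_nonneg _), ENNReal.toReal_ofNat, Real.rpow_two]
      exact Real.sq_sqrt (hsn x)
    rw [eH, he, ENNReal.toReal_ofReal (by positivity), ← Real.rpow_natCast, ← Real.rpow_mul hn]
    norm_num
  rw [← i3, ← ir, ← iH]
  have hfin : W * C ^ 2 * (eLpNorm g (ENNReal.ofReal r) Q * eLpNorm (hessN u) 2 Q ^ 2) ≠ ⊤ :=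
    ENNReal.mul_ne_top (ENNReal.mul_ne_top hW' (ENNReal.pow_ne_top hC))
      (ENNReal.mul_ne_top nr.eLpNorm_ne_top (ENNReal.pow_ne_top nH.eLpNorm_ne_top))
  have b4 := ENNReal.toReal_mono hfin b3
  rw [ENNReal.toReal_mul, ENNReal.toReal_mul (a := eLpNorm g (ENNReal.ofReal r) Q),
    ENNReal.toReal_pow, ENNReal.toReal_pow] at b4
  have : 0 ≤ (eLpNorm g (ENNReal.ofReal r) Q).toReal * (eLpNorm (hessN u) 2 Q).toReal ^ 2 := by
    positivity
  linarith
end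
end
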